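/- arXiv:1712.07139 — 4 statements merged into one kernel-verified Lean document; each statement's English description precedes it below -/
import Mathlib

section
/- Let X be a complete metric space, n ≥ 1 an integer, and S ⊆ X an n-rectifiable set. For any L > 0, any metric space (Y,ρ) and any L-Lipschitz map f : X → Y with H^n(f(S)) > 0, there exists ε > 0 such that every L-Lipschitz map g : S → Y with ρ(f(x),g(x)) < ε for each x ∈ S satisfies H^n(g(S)) > 0. -/
open MeasureTheory Metric Set Filter
open scoped NNReal ENNReal Topology

noncomputable section

/-- A set `E` in a metric space is `n`-rectifiable if it is `H^n`-measurable and can be covered,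
up to an `H^n`-null set, by countably many Lipschitz images of subsets of `ℝ^n`. -/
def IsRectifiable {X : Type*} [MetricSpace X] [MeasurableSpace X] [BorelSpace X]
    (n : ℕ) (E : Set X) : Prop :=
  NullMeasurableSet E μH[(n : ℝ)] ∧
    ∃ (A : ℕ → Set (EuclideanSpace ℝ (Fin n))) (f : ℕ → EuclideanSpace ℝ (Fin n) → X),
      (∀ i, ∃ K : ℝ≥0, LipschitzOnWith K (f i) (A i)) ∧
      μH[(n : ℝ)] (E \ ⋃ i, f i '' A i) = 0

/-- A set `S` is purely `n`-unrectifiable if every `n`-rectifiable set meets it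
in an `H^n`-null set. -/
def PurelyUnrectifiable {X : Type*} [MetricSpace X] [MeasurableSpace X] [BorelSpace X]
    (n : ℕ) (S : Set X) : Prop :=
  ∀ E : Set X, IsRectifiable n E → μH[(n : ℝ)] (S ∩ E) = 0

theorem LipschitzOnWith.hausdorffMeasure_image_eq_zero {X Y : Type*} [MetricSpace X]
    [MeasurableSpace X] [BorelSpace X] [MetricSpace Y] [MeasurableSpace Y] [BorelSpace Y]
    {f : X → Y} {K : ℝ≥0} {s : Set X} (hf : LipschitzOnWith K f s) {d : ℝ} (hd : 0 ≤ d)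
    (hs : μH[d] s = 0) : μH[d] (f '' s) = 0 := by
  have := hf.hausdorffMeasure_image_le hd
  rwa [hs, mul_zero, nonpos_iff_eq_zero] at this

section Degree

variable {E : Type*} [NormedAddCommGroup E] [NormedSpace ℝ E]

theorem exists_forall_norm_lt_det_one_add_pos :
    ∃ ρ : ℝ, 0 < ρ ∧ ∀ M : E →L[ℝ] E, ‖M‖ < ρ → 0 < (1 + M).det := by
  have hc : Continuous fun M : E →L[ℝ] E => (1 + M).det :=
    ContinuousLinearMap.continuous_det.comp (continuous_const.add continuous_id)
  have h0 : 0 < (1 + (0 : E →L[ℝ] E)).det := by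
    simp [ContinuousLinearMap.det]
  obtain ⟨ρ, hρ, h⟩ := Metric.eventually_nhds_iff.1 (hc.continuousAt.eventually (lt_mem_nhds h0))
  exact ⟨ρ, hρ, fun M hM => h (by simpa using hM)⟩

variable [FiniteDimensional ℝ E]

theorem exists_forall_norm_le_abs_det_one_add_le (R : ℝ) :
    ∃ D : ℝ, 0 < D ∧ ∀ M : E →L[ℝ] E, ‖M‖ ≤ R → |(1 + M).det| ≤ D := by
  have hc : Continuous fun M : E →L[ℝ] E => (1 + M).det :=
    ContinuousLinearMap.continuous_det.comp (continuous_const.add continuous_id)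
  obtain ⟨D, hD⟩ := (isCompact_closedBall (0 : E →L[ℝ] E) R).exists_bound_of_continuousOn
    hc.continuousOn
  exact ⟨max D 1, by positivity, fun M hM => (hD M (by simpa using hM)).trans (le_max_left _ _)⟩

theorem exists_polynomial_eval_eq_det_one_add_smul (M : E →L[ℝ] E) :
    ∃ p : Polynomial ℝ, p.natDegree ≤ Module.finrank ℝ E ∧ ∀ t, p.eval t = (1 + t • M).det := by
  let b := Module.finBasis ℝ E
  let A := LinearMap.toMatrix b b (M : E →ₗ[ℝ] E)
  refine ⟨Matrix.det ((Polynomial.X : Polynomial ℝ) • A.map Polynomial.C +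
    (1 : Matrix _ _ ℝ).map Polynomial.C), ?_, fun t => ?_⟩
  · simpa using Polynomial.natDegree_det_X_add_C_le A 1
  · rw [ContinuousLinearMap.det, ← LinearMap.det_toMatrix b, ← Polynomial.coe_evalRingHom,
      RingHom.map_det]
    congr 1
    ext i j
    simp [A, Matrix.one_apply, apply_ite, add_comm]
    split_ifs <;> ring

variable [MeasurableSpace E] [BorelSpace E] (μ : Measure E)

theorem integrableOn_det_one_add_smul_fderiv {u : E → E} {C : ℝ≥0} (hu : LipschitzWith C u) (t : ℝ)
    {s : Set E} (hs : μ s ≠ ∞) :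
    IntegrableOn (fun x => (1 + t • fderiv ℝ u x).det) s μ := by
  obtain ⟨D, -, hD⟩ := exists_forall_norm_le_abs_det_one_add_le (E := E) (|t| * C)
  refine Measure.integrableOn_of_bounded (M := D) hs ?_ (Eventually.of_forall fun x => ?_)
  · have h1 : Measurable fun x => 1 + t • fderiv ℝ u x :=
      ((measurable_fderiv ℝ u).const_smul t).const_add 1
    exact (ContinuousLinearMap.continuous_det.measurable.comp h1).aestronglyMeasurable
  · refine hD _ ?_
    rw [norm_smul, Real.norm_eq_abs]
    gcongr
    exact norm_fderiv_le_of_lipschitz ℝ hu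

variable [μ.IsAddHaarMeasure]

theorem addHaar_eq_zero_of_image_eq_zero_of_det_ne_zero {f : E → E} {f' : E → E →L[ℝ] E}
    {s : Set E} (hf' : ∀ x ∈ s, HasFDerivWithinAt f (f' x) s x) (hdet : ∀ x ∈ s, (f' x).det ≠ 0)
    (h0 : μ (f '' s) = 0) : μ s = 0 := by
  have key : ∀ A : E →L[ℝ] E, ∃ δ : ℝ≥0, δ ≠ 0 ∧ (A.det ≠ 0 → ∃ m : ℝ≥0, m ≠ 0 ∧
      ∀ (s : Set E) (f : E → E), ApproximatesLinearOn f A s δ → (m : ℝ≥0∞) * μ s ≤ μ (f '' s)) := by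
    intro A
    by_cases hA : A.det = 0
    · exact ⟨1, one_ne_zero, fun h => absurd hA h⟩
    · have hpos : 0 < |A.det| := abs_pos.2 hA
      have hm : ((|A.det| / 2).toNNReal : ℝ≥0∞) < ENNReal.ofReal |A.det| := by
        change ENNReal.ofReal _ < _
        exact (ENNReal.ofReal_lt_ofReal_iff hpos).2 (by linarith)
      obtain ⟨δ, h1, h2⟩ := ((mul_le_addHaar_image_of_lt_det μ A hm).and self_mem_nhdsWithin).exists
      exact ⟨δ, ne_of_gt h2, fun _ => ⟨_, (Real.toNNReal_pos.2 (by linarith)).ne', h1⟩⟩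
  choose δ hδ hδ' using key
  obtain ⟨t, A, -, -, hst, happ, hA⟩ :=
    exists_partition_approximatesLinearOn_of_hasFDerivWithinAt f s f' hf' δ hδ
  rcases s.eq_empty_or_nonempty with rfl | hne
  · simp
  have hcov : s = ⋃ n, s ∩ t n := by
    rw [← inter_iUnion, inter_eq_left.2 hst]
  rw [hcov, measure_iUnion_null_iff]
  intro n
  obtain ⟨y, hy, hAy⟩ := hA hne n
  obtain ⟨m, hm0, hm⟩ := hδ' (A n) (hAy ▸ hdet y hy)
  have h1 := hm _ _ (happ n)
  rw [measure_mono_null (image_mono inter_subset_left) h0, nonpos_iff_eq_zero, mul_eq_zero] at h1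
  exact h1.resolve_left (by simpa using hm0)

theorem LipschitzOnWith.addHaar_image_eq_zero {f : E → E} {s : Set E} {K : ℝ≥0}
    (hf : LipschitzOnWith K f s) (hs : μ s = 0) : μ (f '' s) = 0 := by
  have h1 : (μH[Module.finrank ℝ E] : Measure E) s = 0 :=
    Measure.absolutelyContinuous_isAddHaarMeasure _ μ hs
  exact Measure.absolutelyContinuous_isAddHaarMeasure μ μH[Module.finrank ℝ E]
    (hf.hausdorffMeasure_image_eq_zero (by positivity) h1)

theorem setIntegral_det_one_add_fderiv_of_lipschitz_small {ρ : ℝ}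
    (hρ : ∀ M : E →L[ℝ] E, ‖M‖ < ρ → 0 < (1 + M).det)
    {u : E → E} {c : ℝ≥0} (hu : LipschitzWith c u) (hc1 : c < 1) (hcρ : c < ρ) {s : Set E}
    (hs : MeasurableSet s) (hus : ∀ x ∉ s, u x = 0) :
    ∫ x in s, (1 + fderiv ℝ u x).det ∂μ = μ.real s := by
  set F : E → E := fun x => x + u x with hF
  have happ : ApproximatesLinearOn F ((ContinuousLinearEquiv.refl ℝ E : E ≃L[ℝ] E) : E →L[ℝ] E)
      univ c := by
    rw [ApproximatesLinearOn.approximatesLinearOn_iff_lipschitzOnWith]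
    have : F - (((ContinuousLinearEquiv.refl ℝ E : E ≃L[ℝ] E) : E →L[ℝ] E) : E → E) = u := by
      ext x; simp [hF]
    rw [this]
    exact hu.lipschitzOnWith
  have hN : Subsingleton E ∨
      c < ‖((ContinuousLinearEquiv.refl ℝ E).symm : E →L[ℝ] E)‖₊⁻¹ := by
    rcases subsingleton_or_nontrivial E with h | h
    · exact Or.inl h
    · right
      have : ‖((ContinuousLinearEquiv.refl ℝ E).symm : E →L[ℝ] E)‖₊ = 1 := by
        simp
      rw [this]; simpa using hc1
  have hinj : Function.Injective F := injOn_univ.1 (happ.injOn hN)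
  have hsurj : Function.Surjective F := happ.surjective hN
  have himage : F '' s = s := by
    have hcompl : F '' sᶜ = sᶜ := by
      have : EqOn F id sᶜ := fun x hx => by simp [hF, hus x hx]
      rw [this.image_eq, image_id]
    rw [image_compl_eq ⟨hinj, hsurj⟩] at hcompl
    exact compl_injective hcompl
  set d : Set E := {x | DifferentiableAt ℝ u x}
  have hd : MeasurableSet d := measurableSet_of_differentiableAt ℝ u
  have hd0 : μ dᶜ = 0 := hu.ae_differentiableAt
  have hFlip : LipschitzWith (1 + c) F := LipschitzWith.id.add hu
  have himage' : μ (F '' (s ∩ d)) = μ s := by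
    conv_rhs => rw [← himage, ← inter_union_sdiff s d, image_union]
    refine (measure_congr (union_ae_eq_left_of_ae_eq_empty (ae_eq_empty.2 ?_))).symm
    exact hFlip.lipschitzOnWith.addHaar_image_eq_zero μ
      (measure_mono_null (fun x hx => hx.2) hd0)
  have h1 := lintegral_abs_det_fderiv_eq_addHaar_image μ (hs.inter hd)
    (f := F) (f' := fun x => 1 + fderiv ℝ u x)
    (fun x hx => ((hasFDerivAt_id x).add hx.2.hasFDerivAt).hasFDerivWithinAt) hinj.injOn
  have hpos : ∀ x, 0 < (1 + fderiv ℝ u x).det := fun x =>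
    hρ _ ((norm_fderiv_le_of_lipschitz ℝ hu).trans_lt hcρ)
  have hae : (s ∩ d : Set E) =ᵐ[μ] s := inter_ae_eq_left_of_ae_eq_univ (by
    rw [ae_eq_univ]; exact hd0)
  rw [himage', setLIntegral_congr hae] at h1
  rw [integral_eq_lintegral_of_nonneg_ae (Eventually.of_forall fun x => (hpos x).le), measureReal_def,
    ← h1]
  · simp only [abs_of_pos (hpos _)]
  · exact (ContinuousLinearMap.continuous_det.measurable.comp
      ((measurable_fderiv ℝ u).const_add 1)).aestronglyMeasurable

/-- A compactly supported Lipschitz perturbation of the identity has degree one. -/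
theorem setIntegral_det_one_add_fderiv {u : E → E} {C : ℝ≥0} (hu : LipschitzWith C u) {s : Set E}
    (hs : MeasurableSet s) (hs' : μ s ≠ ∞) (hus : ∀ x ∉ s, u x = 0) :
    ∫ x in s, (1 + fderiv ℝ u x).det ∂μ = μ.real s := by
  obtain ⟨ρ, hρ, hdet⟩ := exists_forall_norm_lt_det_one_add_pos (E := E)
  obtain ⟨τ, hτ, hτ1, hτρ⟩ : ∃ τ : ℝ, 0 < τ ∧ τ * C < 1 ∧ τ * C < ρ := by
    have : 0 < min 1 ρ / (C + 1) := by positivity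
    refine ⟨min 1 ρ / (C + 1), this, ?_, ?_⟩ <;>
    · have h : min 1 ρ / (C + 1) * C < min 1 ρ := by
        rw [div_mul_eq_mul_div, div_lt_iff₀ (by positivity)]
        have : 0 < min 1 ρ := by positivity
        nlinarith
      first | exact h.trans_le (min_le_left _ _) | exact h.trans_le (min_le_right _ _)
  set N := Module.finrank ℝ E
  let v : ℕ → ℝ := fun i => τ / (i + 1)
  have hv0 : ∀ i, 0 < v i := fun i => by positivity
  have hvτ : ∀ i, v i ≤ τ := fun i => div_le_self hτ.le (by simp)
  have hvinj : Function.Injective v := by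
    intro i j hij
    have h : τ / ((i : ℝ) + 1) = τ / ((j : ℝ) + 1) := hij
    rw [div_eq_div_iff (by positivity) (by positivity)] at h
    exact_mod_cast (add_right_cancel (mul_left_cancel₀ hτ.ne' h)).symm
  let w : ℕ → ℝ := fun i => (Lagrange.basis (Finset.range (N + 1)) v i).eval 1
  have hw : ∑ i ∈ Finset.range (N + 1), w i = 1 := by
    have := congrArg (Polynomial.eval 1)
      (Lagrange.sum_basis (s := Finset.range (N + 1)) hvinj.injOn (by simp))
    simpa [Polynomial.eval_finsetSum] using this
  have hsmall : ∀ i, ∫ x in s, (1 + v i • fderiv ℝ u x).det ∂μ = μ.real s := by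
    intro i
    have hlip : LipschitzWith ((v i).toNNReal * C) (fun x => v i • u x) := by
      refine LipschitzWith.of_dist_le_mul fun x y => ?_
      rw [dist_smul₀, Real.norm_of_nonneg (hv0 i).le, NNReal.coe_mul, Real.coe_toNNReal _ (hv0 i).le,
        mul_assoc]
      exact mul_le_mul_of_nonneg_left (hu.dist_le_mul x y) (hv0 i).le
    have hle : (((v i).toNNReal * C : ℝ≥0) : ℝ) ≤ τ * C := by
      rw [NNReal.coe_mul, Real.coe_toNNReal _ (hv0 i).le]
      exact mul_le_mul_of_nonneg_right (hvτ i) C.2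
    have := setIntegral_det_one_add_fderiv_of_lipschitz_small μ hdet hlip
      (by rw [← NNReal.coe_lt_coe]; exact hle.trans_lt hτ1) (hle.trans_lt hτρ) hs
      (fun x hx => by simp [hus x hx])
    rw [← this]
    congr with x
    congr 2
    exact (congrFun (fderiv_const_smul_field (v i)) x).symm
  have hpoint : ∀ x, (1 + fderiv ℝ u x).det =
      ∑ i ∈ Finset.range (N + 1), w i * (1 + v i • fderiv ℝ u x).det := by
    intro x
    obtain ⟨p, hp, hpe⟩ := exists_polynomial_eval_eq_det_one_add_smul (fderiv ℝ u x)
    have h := Lagrange.eq_interpolate (s := Finset.range (N + 1)) (v := v) (f := p) hvinj.injOn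
      (lt_of_le_of_lt Polynomial.degree_le_natDegree (by
        rw [Finset.card_range]; exact_mod_cast Nat.lt_succ_of_le hp))
    have h1 := congrArg (Polynomial.eval 1) h
    rw [hpe, one_smul, Lagrange.interpolate_apply, Polynomial.eval_finsetSum] at h1
    rw [h1]
    refine Finset.sum_congr rfl fun i _ => ?_
    simp [w, hpe, mul_comm]
  simp only [hpoint]
  rw [integral_finsetSum]
  · simp only [integral_const_mul, hsmall]
    rw [← Finset.sum_mul, hw, one_mul]
  · intro i _
    exact (integrableOn_det_one_add_smul_fderiv μ hu (v i) hs').const_mul _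

end Degree

section Stability

variable {E : Type*} [NormedAddCommGroup E] [NormedSpace ℝ E] [FiniteDimensional ℝ E]

theorem exists_closedBall_lipschitzWith_eqOn {B : Set E} {u : E → E} {C : ℝ≥0}
    (hu : LipschitzOnWith C u B) {x₀ : E} {r δ : ℝ} (hr : 0 < r) (hδ : 0 < δ)
    (hbound : ∀ x ∈ B ∩ closedBall x₀ ((1 - δ) * r), ‖u x‖ ≤ δ * r) :
    ∃ v : E → E, LipschitzWith (lipschitzExtensionConstant E * (C + 1)) v ∧
      EqOn v u (B ∩ closedBall x₀ ((1 - δ) * r)) ∧ ∀ x ∉ closedBall x₀ r, v x = 0 := by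
  classical
  set I := B ∩ closedBall x₀ ((1 - δ) * r)
  have hIs : I ⊆ closedBall x₀ r := fun x hx =>
    closedBall_subset_closedBall (by nlinarith) hx.2
  set w : E → E := (closedBall x₀ r).piecewise u 0
  have hwI : ∀ x ∈ I, w x = u x := fun x hx => piecewise_eq_of_mem _ _ _ (hIs hx)
  have hwO : ∀ x ∉ closedBall x₀ r, w x = 0 := fun x hx => piecewise_eq_of_notMem _ _ _ hx
  have hmix : ∀ x ∈ I, ∀ y ∉ closedBall x₀ r, ‖u x‖ ≤ (C + 1) * dist x y := by
    intro x hx y hy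
    rw [mem_closedBall, not_le] at hy
    have h1 := hx.2
    rw [mem_closedBall] at h1
    have h2 := dist_triangle y x x₀
    rw [dist_comm y x] at h2
    have h3 := hbound x hx
    have h4 : 0 ≤ (C : ℝ) * dist x y := by positivity
    nlinarith
  have hw : LipschitzOnWith (C + 1) w (I ∪ (closedBall x₀ r)ᶜ) := by
    refine LipschitzOnWith.of_dist_le_mul ?_
    push_cast
    rintro x (hx | hx) y (hy | hy)
    · rw [hwI x hx, hwI y hy]
      refine (hu.dist_le_mul x hx.1 y hy.1).trans ?_
      gcongr
      simp
    · rw [hwI x hx, hwO y hy, dist_zero_right]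
      exact hmix x hx y hy
    · rw [hwO x hx, hwI y hy, dist_zero_left, dist_comm]
      exact hmix y hy x hx
    · rw [hwO x hx, hwO y hy, dist_self]
      positivity
  obtain ⟨v, hv, hvw⟩ := hw.extend_finite_dimension
  exact ⟨v, hv, fun x hx => (hvw (Or.inl hx)).symm.trans (hwI x hx),
    fun x hx => (hvw (Or.inr hx)).symm.trans (hwO x hx)⟩

variable [MeasurableSpace E] [BorelSpace E] (μ : Measure E) [μ.IsAddHaarMeasure]

theorem LipschitzWith.exists_density_point_det_ne_zero {F : E → E} {K : ℝ≥0}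
    (hF : LipschitzWith K F) {B : Set E} (hpos : μ (F '' B) ≠ 0) :
    ∃ x ∈ B, DifferentiableAt ℝ F x ∧ (fderiv ℝ F x).det ≠ 0 ∧
      Tendsto (fun r => μ (B ∩ closedBall x r) / μ (closedBall x r)) (𝓝[>] 0) (𝓝 1) := by
  by_contra! hcon
  apply hpos
  set D : Set E := {x | DifferentiableAt ℝ F x ∧
    Tendsto (fun r => μ (B ∩ closedBall x r) / μ (closedBall x r)) (𝓝[>] 0) (𝓝 1)}
  have h1 : μ (B \ D) = 0 := by
    have h2 : μ.restrict B Dᶜ = 0 := by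
      filter_upwards [ae_restrict_of_ae (s := B) (hF.ae_differentiableAt (μ := μ)),
        Besicovitch.ae_tendsto_measure_inter_div μ B] with x hx1 hx2 using ⟨hx1, hx2⟩
    have h3 := Measure.le_restrict_apply B Dᶜ (μ := μ)
    rw [h2] at h3
    rw [sdiff_eq, inter_comm]
    exact nonpos_iff_eq_zero.1 h3
  have h2 : μ (F '' (B ∩ D)) = 0 :=
    addHaar_image_eq_zero_of_det_fderivWithin_eq_zero μ
      (fun x hx => hx.2.1.hasFDerivAt.hasFDerivWithinAt) (fun x hx => by
        by_contra h
        exact hcon x hx.1 hx.2.1 h hx.2.2)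
  rw [← inter_union_sdiff B D, image_union]
  exact measure_union_null h2 (hF.lipschitzOnWith.addHaar_image_eq_zero μ h1)

/-- If `id + u` maps a subset `I` of `s` to a null set, then `I` leaves out a definite proportion
of `s`. -/
theorem measureReal_le_mul_measureReal_sdiff {u : E → E} {C : ℝ≥0} (hu : LipschitzWith C u)
    {s I : Set E} (hs : MeasurableSet s) (hs' : μ s ≠ ∞) (hus : ∀ x ∉ s, u x = 0)
    (hI : MeasurableSet I) (hIs : I ⊆ s) (h0 : μ ((fun x => x + u x) '' I) = 0) {D : ℝ}
    (hD : ∀ M : E →L[ℝ] E, ‖M‖ ≤ C → |(1 + M).det| ≤ D) :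
    μ.real s ≤ D * μ.real (s \ I) := by
  have hint : IntegrableOn (fun x => (1 + fderiv ℝ u x).det) s μ := by
    simpa using integrableOn_det_one_add_smul_fderiv μ hu 1 hs'
  have hae : ∀ᵐ x ∂μ, x ∈ I → (1 + fderiv ℝ u x).det = 0 := by
    have h1 : μ {x | x ∈ I ∧ DifferentiableAt ℝ u x ∧ (1 + fderiv ℝ u x).det ≠ 0} = 0 :=
      addHaar_eq_zero_of_image_eq_zero_of_det_ne_zero μ (f := fun x => x + u x)
        (f' := fun x => 1 + fderiv ℝ u x)
        (fun x hx => ((hasFDerivAt_id x).add hx.2.1.hasFDerivAt).hasFDerivWithinAt)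
        (fun x hx => hx.2.2) (measure_mono_null (image_mono fun x hx => hx.1) h0)
    filter_upwards [hu.ae_differentiableAt (μ := μ), compl_mem_ae_iff.2 h1] with x hx1 hx2 hxI
    by_contra h
    exact hx2 ⟨hxI, hx1, h⟩
  have h1 := setIntegral_det_one_add_fderiv μ hu hs hs' hus
  rw [← integral_inter_add_sdiff hI hint, inter_eq_right.2 hIs,
    setIntegral_eq_zero_of_ae_eq_zero hae, zero_add] at h1
  rw [← h1]
  refine (Real.le_norm_self _).trans ?_
  exact norm_setIntegral_le_of_norm_le_const
    (lt_of_le_of_lt (measure_mono sdiff_subset) (lt_top_iff_ne_top.2 hs'))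
    (fun x _ => (Real.norm_eq_abs _).trans_le <| hD _ (norm_fderiv_le_of_lipschitz ℝ hu))

/-- Positivity of the measure of the image is stable under uniform perturbations among
Lipschitz maps with a fixed constant. -/
theorem exists_forall_dist_lt_addHaar_image_pos {B : Set E} (hB : MeasurableSet B) {F : E → E}
    {K : ℝ≥0} (hF : LipschitzOnWith K F B) (hpos : μ (F '' B) ≠ 0) :
    ∃ ε : ℝ, 0 < ε ∧ ∀ G : E → E, LipschitzOnWith K G B → (∀ x ∈ B, dist (F x) (G x) < ε) →
      μ (G '' B) ≠ 0 := by
  obtain ⟨F', hF', hFF'⟩ := hF.extend_finite_dimension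
  rw [hFF'.image_eq] at hpos
  obtain ⟨x₀, -, hdiff, hdet, hdens⟩ := hF'.exists_density_point_det_ne_zero μ hpos
  set A := (fderiv ℝ F' x₀).toContinuousLinearEquivOfDetNeZero hdet
  set T : E →L[ℝ] E := (A.symm : E →L[ℝ] E)
  have hTA : ∀ v, T (fderiv ℝ F' x₀ v) = v := fun v => A.symm_apply_apply v
  set a : ℝ := ‖T‖ + 1
  have ha : 0 < a := by positivity
  set C : ℝ≥0 := ‖T‖₊ * K + 1
  obtain ⟨D, hD, hDle⟩ := exists_forall_norm_le_abs_det_one_add_le (E := E)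
    (lipschitzExtensionConstant E * (C + 1) : ℝ≥0)
  set N := Module.finrank ℝ E
  obtain ⟨δ, hδN, hδ⟩ : ∃ δ : ℝ, 1 - 1 / (2 * D) < (1 - δ) ^ N ∧ δ ∈ Ioo (0 : ℝ) 1 := by
    have hc : Continuous fun δ : ℝ => (1 - δ) ^ N := by fun_prop
    have h0 : 1 - 1 / (2 * D) < (fun δ : ℝ => (1 - δ) ^ N) 0 := by
      simp only [sub_zero, one_pow]
      have : 0 < 1 / (2 * D) := by positivity
      linarith
    have h1 : ∀ᶠ δ : ℝ in 𝓝[>] 0, 1 - 1 / (2 * D) < (1 - δ) ^ N :=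
      nhdsWithin_le_nhds (hc.continuousAt.eventually (lt_mem_nhds h0))
    exact (h1.and (Ioo_mem_nhdsGT one_pos)).exists
  have hclose : ∀ᶠ x in 𝓝 x₀, ‖F' x - F' x₀ - fderiv ℝ F' x₀ (x - x₀)‖ ≤ δ / (2 * a) * ‖x - x₀‖ :=
    hdiff.hasFDerivAt.isLittleO.bound (div_pos hδ.1 (by positivity))
  obtain ⟨R, hR, hRclose⟩ := Metric.eventually_nhds_iff.1 hclose
  have hdens' : ∀ᶠ r in 𝓝[>] (0 : ℝ), ENNReal.ofReal (1 - 1 / (2 * D)) <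
      μ (B ∩ closedBall x₀ r) / μ (closedBall x₀ r) := by
    refine hdens.eventually (lt_mem_nhds ?_)
    rw [ENNReal.ofReal_lt_one]
    have : 0 < 1 / (2 * D) := by positivity
    linarith
  obtain ⟨r, hrdens, hr, hrR⟩ := (hdens'.and (Ioo_mem_nhdsGT hR)).exists
  refine ⟨δ * r / (2 * a), by have := hδ.1; positivity, fun G hG hFG h0 => ?_⟩
  set s := closedBall x₀ r
  set I := B ∩ closedBall x₀ ((1 - δ) * r)
  have hIs : I ⊆ s := fun x hx => closedBall_subset_closedBall (by nlinarith [hδ.1]) hx.2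
  set u₀ : E → E := fun x => T (G x - F' x₀) - (x - x₀)
  have hu₀ : LipschitzOnWith C u₀ B := by
    refine LipschitzOnWith.of_dist_le_mul fun x hx y hy => ?_
    have h1 := hG.dist_le_mul x hx y hy
    have h2 : u₀ x - u₀ y = T (G x - G y) - (x - y) := by
      simp only [u₀, map_sub]; abel
    rw [dist_eq_norm, h2]
    rw [dist_eq_norm, dist_eq_norm] at h1
    refine (norm_sub_le _ _).trans ?_
    rw [dist_eq_norm]
    have h3 := (T.le_opNorm (G x - G y)).trans (mul_le_mul_of_nonneg_left h1 (norm_nonneg T))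
    simp only [C, NNReal.coe_add, NNReal.coe_mul, coe_nnnorm, NNReal.coe_one]
    linarith
  have hbound : ∀ x ∈ I, ‖u₀ x‖ ≤ δ * r := by
    intro x hx
    have h2 : u₀ x = T ((G x - F' x) + (F' x - F' x₀ - fderiv ℝ F' x₀ (x - x₀))) := by
      simp only [u₀, map_add, map_sub, hTA]; abel
    have h3 : dist x x₀ ≤ r := hIs hx
    have h4 := hRclose (h3.trans_lt hrR)
    have h5 := hFG x hx.1
    rw [hFF' hx.1, dist_comm, dist_eq_norm] at h5
    rw [dist_eq_norm] at h3
    have h6 : δ / (2 * a) * ‖x - x₀‖ ≤ δ / (2 * a) * r :=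
      mul_le_mul_of_nonneg_left h3 (div_nonneg hδ.1.le (by positivity))
    have h7 : ‖(G x - F' x) + (F' x - F' x₀ - fderiv ℝ F' x₀ (x - x₀))‖ ≤ δ * r / a := by
      refine (norm_add_le _ _).trans ((add_le_add h5.le (h4.trans h6)).trans_eq ?_)
      field_simp; norm_num
    rw [h2]
    refine (T.le_opNorm _).trans ?_
    calc ‖T‖ * _ ≤ a * (δ * r / a) := by
          refine mul_le_mul (by simp [a]) h7 (norm_nonneg _) ha.le
      _ = δ * r := by field_simp
  obtain ⟨u, hu, huI, hus⟩ := exists_closedBall_lipschitzWith_eqOn hu₀ hr hδ.1 hbound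
  have himage : μ ((fun x => x + u x) '' I) = 0 := by
    have h1 : (fun x => x + u x) '' I ⊆ (fun y => T (y - F' x₀) + x₀) '' (G '' B) := by
      rintro _ ⟨x, hx, rfl⟩
      refine ⟨G x, mem_image_of_mem _ hx.1, ?_⟩
      simp only [huI hx, u₀]
      abel
    refine measure_mono_null h1 (LipschitzOnWith.addHaar_image_eq_zero μ (K := ‖T‖₊) ?_ h0)
    refine LipschitzOnWith.of_dist_le_mul fun x _ y _ => ?_
    rw [dist_add_right, dist_eq_norm, ← map_sub, sub_sub_sub_cancel_right, dist_eq_norm]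
    exact T.le_opNorm _
  have hs' : μ s ≠ ∞ := measure_closedBall_lt_top.ne
  have hVpos : 0 < μ.real s :=
    ENNReal.toReal_pos (measure_closedBall_pos μ x₀ hr).ne' hs'
  have hmain := measureReal_le_mul_measureReal_sdiff μ hu measurableSet_closedBall hs' hus
    (hB.inter measurableSet_closedBall) hIs himage hDle
  have hlarge : (1 - 1 / (2 * D)) * μ.real s < μ.real (B ∩ s) := by
    have h1 : (1 - 1 / (2 * D)) < μ.real (B ∩ s) / μ.real s := by
      by_contra! h
      have h2 := ENNReal.ofReal_le_ofReal h
      rw [measureReal_def, measureReal_def, ← ENNReal.toReal_div, ENNReal.ofReal_toReal] at h2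
      · exact hrdens.not_ge h2
      · exact ENNReal.div_ne_top (measure_ne_top_of_subset inter_subset_right hs')
          (measure_closedBall_pos μ x₀ hr).ne'
    rwa [lt_div_iff₀ hVpos] at h1
  have hsB : μ.real (s \ B) < 1 / (2 * D) * μ.real s := by
    have := measureReal_inter_add_sdiff (μ := μ) (s := s) hB hs'
    rw [inter_comm] at this
    linarith
  have hsr : μ.real (s \ closedBall x₀ ((1 - δ) * r)) < 1 / (2 * D) * μ.real s := by
    have h1 : closedBall x₀ ((1 - δ) * r) ⊆ s := closedBall_subset_closedBall (by nlinarith [hδ.1])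
    have h2 : μ.real (closedBall x₀ ((1 - δ) * r)) = (1 - δ) ^ N * μ.real s := by
      rw [measureReal_def, measureReal_def, Measure.addHaar_closedBall μ x₀ hr.le,
        Measure.addHaar_closedBall μ x₀ (mul_nonneg (by linarith [hδ.2]) hr.le), mul_pow,
        ENNReal.ofReal_mul (pow_nonneg (by linarith [hδ.2]) _), mul_assoc, ENNReal.toReal_mul,
        ENNReal.toReal_ofReal (pow_nonneg (by linarith [hδ.2]) _)]
    rw [measureReal_sdiff h1 measurableSet_closedBall, h2]
    nlinarith
  have hsub : μ.real (s \ I) ≤ μ.real (s \ B) + μ.real (s \ closedBall x₀ ((1 - δ) * r)) := by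
    rw [show s \ I = s \ B ∪ s \ closedBall x₀ ((1 - δ) * r) from sdiff_inter]
    exact measureReal_union_le _ _
  have : D * μ.real (s \ I) < D * (1 / (2 * D) * μ.real s + 1 / (2 * D) * μ.real s) :=
    mul_lt_mul_of_pos_left (by linarith) hD
  have h2 : D * (1 / (2 * D) * μ.real s + 1 / (2 * D) * μ.real s) = μ.real s := by
    field_simp; norm_num
  linarith

end Stability

section Line

theorem ae_exists_forall_abs_sub_le_of_abs_deriv_le {ψ : ℕ → ℝ → ℝ} {K : ℝ≥0}
    (hψ : ∀ k, LipschitzWith K (ψ k)) {a : ℝ} (ha : 0 < a) {M : Set ℝ} (hM : MeasurableSet M)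
    (hMa : ∀ t ∈ M, ∀ k, |deriv (ψ k) t| ≤ a) :
    ∀ᵐ t, t ∈ M → ∃ j : ℕ, ∀ s : ℝ, |s| < 1 / (j + 1) → ∀ k,
      |ψ k (t + s) - ψ k t| ≤ 2 * a * |s| := by
  have h0 := Besicovitch.ae_tendsto_measure_inter_div (volume : Measure ℝ) M
  rw [ae_restrict_iff' hM] at h0
  filter_upwards [h0] with t ht htM
  have hc : 0 < a / (2 * (K + 1)) := by positivity
  have h1 : ∀ᶠ r in 𝓝[>] (0 : ℝ), ENNReal.ofReal (1 - a / (2 * (K + 1))) <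
      volume (M ∩ closedBall t r) / volume (closedBall t r) := by
    refine (ht htM).eventually (lt_mem_nhds ?_)
    rw [ENNReal.ofReal_lt_one]
    linarith
  obtain ⟨r₀, hr₀, hr⟩ := mem_nhdsGT_iff_exists_Ioo_subset.1 h1
  obtain ⟨j, hj⟩ := exists_nat_one_div_lt (mem_Ioi.1 hr₀)
  refine ⟨j, fun s hs k => ?_⟩
  rcases eq_or_ne s 0 with rfl | hs0
  · simp
  have hspos : 0 < |s| := abs_pos.2 hs0
  have hcb : volume.real (closedBall t |s|) = 2 * |s| := by
    rw [measureReal_def, Real.volume_closedBall, ENNReal.toReal_ofReal (by positivity)]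
  have hcb' : volume (closedBall t |s|) ≠ ∞ := measure_closedBall_lt_top.ne
  have h2 : (1 - a / (2 * (K + 1))) * (2 * |s|) < volume.real (M ∩ closedBall t |s|) := by
    rw [← lt_div_iff₀ (by positivity), ← hcb]
    by_contra! h
    have h2 := ENNReal.ofReal_le_ofReal h
    rw [measureReal_def, measureReal_def, ← ENNReal.toReal_div, ENNReal.ofReal_toReal] at h2
    · exact (hr ⟨hspos, hs.trans hj⟩).not_ge h2
    · exact ENNReal.div_ne_top (measure_ne_top_of_subset inter_subset_right hcb')
        (measure_closedBall_pos volume t hspos).ne'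
  have h3 : volume.real (closedBall t |s| \ M) < a / (K + 1) * |s| := by
    have h := measureReal_inter_add_sdiff (μ := volume) (s := closedBall t |s|) hM hcb'
    rw [inter_comm, hcb] at h
    have : a / (K + 1) * |s| = a / (2 * (K + 1)) * (2 * |s|) := by field_simp
    linarith
  have hI : uIoc t (t + s) ⊆ closedBall t |s| := by
    intro y hy
    rw [mem_closedBall, Real.dist_eq]
    simpa using abs_sub_left_of_mem_uIcc (uIoc_subset_uIcc hy)
  have hvolI : volume.real (uIoc t (t + s)) = |s| := by
    simp [measureReal_def, Real.volume_uIoc]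
  have hI' : volume (uIoc t (t + s)) ≠ ∞ := measure_ne_top_of_subset hI hcb'
  have hac := ((hψ k).lipschitzOnWith (s := uIcc t (t + s))).absolutelyContinuousOnInterval
  have hint : IntegrableOn (fun x => ‖deriv (ψ k) x‖) (uIoc t (t + s)) :=
    (intervalIntegrable_iff.1 hac.intervalIntegrable_deriv).norm
  rw [← hac.integral_deriv_eq_sub, ← Real.norm_eq_abs]
  refine intervalIntegral.norm_integral_le_integral_norm_uIoc.trans ?_
  rw [← integral_inter_add_sdiff hM hint]
  have h4 : ∫ x in uIoc t (t + s) ∩ M, ‖deriv (ψ k) x‖ ≤ a * |s| := by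
    refine (Real.le_norm_self _).trans ((norm_setIntegral_le_of_norm_le_const
      (measure_lt_top_of_subset inter_subset_left hI') (C := a) fun x hx => ?_).trans ?_)
    · simpa using hMa x hx.2 k
    · rw [← hvolI]
      exact mul_le_mul_of_nonneg_left (measureReal_mono inter_subset_left hI') ha.le
  have h5 : ∫ x in uIoc t (t + s) \ M, ‖deriv (ψ k) x‖ ≤ a * |s| := by
    refine (Real.le_norm_self _).trans ((norm_setIntegral_le_of_norm_le_const
      (measure_lt_top_of_subset sdiff_subset hI') (C := K) fun x hx => ?_).trans ?_)
    · simpa using norm_deriv_le_of_lipschitz (hψ k)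
    · calc K * volume.real (uIoc t (t + s) \ M) ≤ (K + 1) * (a / (K + 1) * |s|) := by
            refine mul_le_mul (by simp) ((measureReal_mono (sdiff_subset_sdiff_left hI)
              (measure_ne_top_of_subset sdiff_subset hcb')).trans h3.le)
              measureReal_nonneg (by positivity)
        _ = a * |s| := by field_simp
  linarith

variable {E : Type*} [NormedAddCommGroup E] [NormedSpace ℝ E]

/-- The set of points around which, up to distance `ρ` in direction `w`, all the functions `H k`
have difference quotients bounded by `a`. -/
def lineSlopeSet (H : ℕ → E → ℝ) (w : E) (a ρ : ℝ) : Set E :=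
  {x | ∀ s : ℝ, |s| < ρ → ∀ k, |H k (x + s • w) - H k x| ≤ a * |s|}

theorem isClosed_lineSlopeSet {H : ℕ → E → ℝ} (hH : ∀ k, Continuous (H k)) (w : E) (a ρ : ℝ) :
    IsClosed (lineSlopeSet H w a ρ) := by
  simp only [lineSlopeSet, ofPred_forall]
  refine isClosed_iInter fun s => isClosed_iInter fun _ => isClosed_iInter fun k => ?_
  exact isClosed_le (((hH k).comp (continuous_id.add continuous_const)).sub (hH k)).abs
    continuous_const

variable [FiniteDimensional ℝ E] [MeasurableSpace E] [BorelSpace E] (μ : Measure E)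
  [μ.IsAddHaarMeasure]

theorem ae_exists_mem_lineSlopeSet {H : ℕ → E → ℝ} {K : ℝ≥0} (hH : ∀ k, LipschitzWith K (H k))
    (w : E) {a : ℝ} (ha : 0 < a) :
    ∀ᵐ x ∂μ, (∀ k, DifferentiableAt ℝ (H k) x ∧ |fderiv ℝ (H k) x w| ≤ a) →
      ∃ j : ℕ, x ∈ lineSlopeSet H w (2 * a) (1 / (j + 1)) := by
  set M : Set E := {x | ∀ k, DifferentiableAt ℝ (H k) x ∧ |fderiv ℝ (H k) x w| ≤ a}
  have hM : MeasurableSet M := by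
    simp only [M, ofPred_forall, ofPred_and]
    refine MeasurableSet.iInter fun k => (measurableSet_of_differentiableAt ℝ (H k)).inter ?_
    exact measurableSet_le (measurable_fderiv_apply_const ℝ (H k) w).abs measurable_const
  have hQ : MeasurableSet {x | x ∈ M → ∃ j : ℕ, x ∈ lineSlopeSet H w (2 * a) (1 / (j + 1))} := by
    have h1 : MeasurableSet (⋃ j : ℕ, lineSlopeSet H w (2 * a) (1 / (j + 1))) :=
      MeasurableSet.iUnion fun j =>
        (isClosed_lineSlopeSet (fun k => (hH k).continuous) w _ _).measurableSet
    convert hM.compl.union h1 using 1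
    ext x
    simp [imp_iff_not_or]
  let Λ : ℝ →L[ℝ] E := ContinuousLinearMap.smulRight (1 : ℝ →L[ℝ] ℝ) w
  refine ae_mem_of_ae_add_linearMap_mem Λ.toLinearMap volume μ hQ fun p => ?_
  have hΛ : ∀ t, Λ.toLinearMap t = t • w := fun t => by simp [Λ]
  have hline := ae_exists_forall_abs_sub_le_of_abs_deriv_le
    (ψ := fun k t => H k (p + t • w)) (K := K * (0 + ‖Λ‖₊)) (M := {t | p + t • w ∈ M})
    (fun k => by
      have := (hH k).comp ((LipschitzWith.const p).add Λ.lipschitz)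
      simpa [Function.comp_def, Λ] using this) ha
    ((by fun_prop : Measurable fun t : ℝ => p + t • w) hM) (fun t ht k => by
      obtain ⟨h1, h2⟩ := ht k
      have h3 : HasDerivAt (fun t : ℝ => p + t • w) w t := by
        simpa using ((hasDerivAt_id t).smul_const w).const_add p
      have h4 : deriv (fun t => H k (p + t • w)) t = fderiv ℝ (H k) (p + t • w) w :=
        (h1.hasFDerivAt.comp_hasDerivAt t h3).deriv
      rwa [h4])
  filter_upwards [hline] with t ht
  rw [hΛ]
  intro h
  obtain ⟨j, hj⟩ := ht h
  refine ⟨j, fun s hs k => ?_⟩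
  have := hj s hs k
  rwa [add_smul, ← add_assoc] at this

end Line

section Collapse

theorem hausdorffMeasure_image_le_of_dist_le {Z V Y : Type*} [Nonempty Z] [MetricSpace V]
    [MeasurableSpace V] [BorelSpace V] [MetricSpace Y] [MeasurableSpace Y] [BorelSpace Y]
    {h : Z → Y} {T : Z → V} {s : Set Z} {C : ℝ≥0}
    (hT : ∀ x ∈ s, ∀ y ∈ s, dist (h x) (h y) ≤ C * dist (T x) (T y)) {d : ℝ} (hd : 0 ≤ d) :
    μH[d] (h '' s) ≤ (C : ℝ≥0∞) ^ d * μH[d] (T '' s) := by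
  have hg : LipschitzOnWith C (h ∘ Function.invFunOn T s) (T '' s) := by
    refine LipschitzOnWith.of_dist_le_mul fun x hx y hy => ?_
    have := hT _ (Function.invFunOn_mem hx) _ (Function.invFunOn_mem hy)
    rwa [Function.invFunOn_eq hx, Function.invFunOn_eq hy] at this
  have himage : h '' s = (h ∘ Function.invFunOn T s) '' (T '' s) := by
    rw [image_image]
    refine image_congr fun x hx => ?_
    have h1 := hT x hx _ (Function.invFunOn_apply_mem (f := T) hx)
    rw [Function.invFunOn_apply_eq (f := T) hx, dist_self, mul_zero] at h1
    exact dist_le_zero.1 h1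
  rw [himage]
  exact hg.hausdorffMeasure_image_le hd

theorem measure_image_iUnion_le_of_forall_subset {α β ι : Type*} [Countable ι] [MeasurableSpace α]
    [MeasurableSpace β] {μ : Measure α} {ν : Measure β} {h : α → β} {P : ι → Set α}
    (hP : ∀ i, MeasurableSet (P i)) {c : ℝ≥0∞} (hc : ∀ i, ∀ s ⊆ P i, ν (h '' s) ≤ c * μ s) :
    ν (h '' ⋃ i, P i) ≤ c * μ (⋃ i, P i) := by
  rcases isEmpty_or_nonempty ι with hι | hι
  · simp
  obtain ⟨e, he⟩ := exists_surjective_nat ι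
  rw [← he.iUnion_comp P, ← iUnion_disjointed, image_iUnion]
  rw [measure_iUnion (disjoint_disjointed _) (MeasurableSet.disjointed fun i => hP (e i)),
    ← ENNReal.tsum_mul_left]
  exact (measure_iUnion_le _).trans
    (ENNReal.tsum_le_tsum fun i => hc (e i) _ (disjointed_subset _ i))

variable {E : Type*} [NormedAddCommGroup E] [InnerProductSpace ℝ E]

open scoped RealInnerProductSpace

theorem norm_sub_inner_smul_le {w : E} (hw : ‖w‖ = 1) (u : E) : ‖u - ⟪w, u⟫ • w‖ ≤ ‖u‖ := by
  rw [← abs_of_nonneg (norm_nonneg u), ← abs_of_nonneg (norm_nonneg (u - _)), ← sq_le_sq,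
    norm_sub_sq_real, norm_smul, hw, inner_smul_right, real_inner_comm, mul_one, Real.norm_eq_abs,
    sq_abs]
  nlinarith [sq_nonneg ⟪w, u⟫]

variable [FiniteDimensional ℝ E] [MeasurableSpace E] [BorelSpace E]
  {Y : Type*} [MetricSpace Y] [MeasurableSpace Y] [BorelSpace Y]

theorem hausdorffMeasure_image_le_of_subset_lineSlopeSet {h : E → Y} {H : ℕ → E → ℝ} {K : ℝ≥0}
    (hH : ∀ k, LipschitzWith K (H k)) {s : Set E}
    (hs : ∀ x ∈ s, ∀ y ∈ s, ∀ c, (∀ k, |H k x - H k y| ≤ c) → dist (h x) (h y) ≤ c)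
    {w : E} (hw : ‖w‖ = 1) {η ρ : ℝ} (hη : 0 < η)
    (hsw : s ⊆ lineSlopeSet H w (2 * (K * η)) ρ) {q : E} (hsq : s ⊆ ball q (ρ / 2)) :
    μH[Module.finrank ℝ E] (h '' s) ≤ ((3 * K : ℝ≥0) : ℝ≥0∞) ^ (Module.finrank ℝ E : ℝ) *
      ENNReal.ofReal η * μH[Module.finrank ℝ E] s := by
  set T : E →ₗ[ℝ] E := LinearMap.transvection (innerSL ℝ w : E →ₗ[ℝ] ℝ) (-(1 - η) • w)
  have hT : ∀ v, T v = v - ((1 - η) * ⟪w, v⟫) • w := fun v => by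
    simp only [T, LinearMap.transvection.apply, ContinuousLinearMap.coe_coe, innerSL_apply_apply]
    module
  have hdet : LinearMap.det T = η := by
    simp only [T, LinearMap.transvection.det, ContinuousLinearMap.coe_coe, innerSL_apply_apply,
      inner_smul_right, real_inner_self_eq_norm_sq, hw]
    ring
  have hwT : ∀ v, ⟪w, T v⟫ = η * ⟪w, v⟫ := fun v => by
    rw [hT, inner_sub_right, inner_smul_right, real_inner_self_eq_norm_sq, hw]
    ring
  have hTw : ∀ v, T v - ⟪w, T v⟫ • w = v - ⟪w, v⟫ • w := fun v => by
    rw [hwT, hT]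
    module
  have hdist : ∀ x ∈ s, ∀ y ∈ s, dist (h x) (h y) ≤ (3 * K : ℝ≥0) * dist (T x) (T y) := by
    intro x hx y hy
    set v := x - y
    set t := ⟪w, v⟫
    have hTv : dist (T x) (T y) = ‖T v‖ := by rw [dist_eq_norm, ← map_sub]
    have ht : |t| < ρ := by
      have h1 := abs_real_inner_le_norm w v
      rw [hw, one_mul, ← dist_eq_norm] at h1
      have h2 := dist_triangle_right x y q
      have h3 := hsq hx
      have h4 := hsq hy
      rw [mem_ball] at h3 h4
      linarith
    have hηt : η * |t| ≤ ‖T v‖ := by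
      have h1 := abs_real_inner_le_norm w (T v)
      rwa [hw, one_mul, hwT, abs_mul, abs_of_pos hη] at h1
    have hperp : ‖v - t • w‖ ≤ ‖T v‖ := hTw v ▸ norm_sub_inner_smul_le hw (T v)
    refine hs x hx y hy _ fun k => ?_
    have h1 := hsw hy t ht k
    have h2 : |H k x - H k (y + t • w)| ≤ K * ‖v - t • w‖ := by
      have := (hH k).dist_le_mul x (y + t • w)
      rwa [Real.dist_eq, dist_eq_norm, ← sub_sub] at this
    have h3 := abs_sub_le (H k x) (H k (y + t • w)) (H k y)
    have h4 : (K : ℝ) * ‖v - t • w‖ ≤ K * ‖T v‖ := by gcongr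
    have h5 : (K : ℝ) * (η * |t|) ≤ K * ‖T v‖ := by gcongr
    rw [hTv]
    push_cast
    linarith
  have := hausdorffMeasure_image_le_of_dist_le hdist (d := Module.finrank ℝ E) (by positivity)
  rwa [Measure.addHaar_image_linearMap, hdet, abs_of_pos hη, ← mul_assoc] at this

/-- If the distance functions describing `h` share, at almost every point of `B`, a direction in
which all their derivatives vanish, then `h '' B` has measure zero. -/
theorem hausdorffMeasure_image_eq_zero_of_common_kernel {h : E → Y} {H : ℕ → E → ℝ} {K : ℝ≥0}
    (hK : 0 < K) (hH : ∀ k, LipschitzWith K (H k)) {B : Set E} (hB : MeasurableSet B)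
    (hB' : μH[Module.finrank ℝ E] B ≠ ∞)
    (hs : ∀ x ∈ B, ∀ y ∈ B, ∀ c, (∀ k, |H k x - H k y| ≤ c) → dist (h x) (h y) ≤ c)
    (hker : ∀ᵐ x ∂(μH[Module.finrank ℝ E] : Measure E), x ∈ B →
      (∀ k, DifferentiableAt ℝ (H k) x) ∧ ∃ v : E, ‖v‖ = 1 ∧ ∀ k, fderiv ℝ (H k) x v = 0) :
    μH[Module.finrank ℝ E] (h '' B) = 0 := by
  set N := Module.finrank ℝ E
  have hlip : LipschitzOnWith K h B := LipschitzOnWith.of_dist_le_mul fun x hx y hy =>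
    hs x hx y hy _ fun k => (hH k).dist_le_mul x y
  obtain ⟨W, hWc, hWd⟩ := TopologicalSpace.exists_countable_dense (sphere (0 : E) 1)
  obtain ⟨Q, hQc, hQd⟩ := TopologicalSpace.exists_countable_dense E
  have := hWc.to_subtype
  have := hQc.to_subtype
  have key : ∀ η : ℝ, 0 < η → μH[N] (h '' B) ≤
      (((3 * K : ℝ≥0) : ℝ≥0∞) ^ (N : ℝ) * μH[N] B) * ENNReal.ofReal η := by
    intro η hη
    have hKη : 0 < (K : ℝ) * η := by positivity
    let P : W × ℕ × Q → Set E := fun i => B ∩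
      lineSlopeSet H (i.1 : sphere (0 : E) 1) (2 * (K * η)) (1 / (i.2.1 + 1)) ∩
        ball i.2.2 (1 / (i.2.1 + 1) / 2)
    have hP : ∀ i, MeasurableSet (P i) := fun i => (hB.inter
      (isClosed_lineSlopeSet (fun k => (hH k).continuous) _ _ _).measurableSet).inter
        measurableSet_ball
    have hPB : ⋃ i, P i ⊆ B := iUnion_subset fun i x hx => hx.1.1
    have hnull : μH[N] (B \ ⋃ i, P i) = 0 := by
      have hslope : ∀ᵐ x ∂(μH[N] : Measure E), ∀ w : W,
          (∀ k, DifferentiableAt ℝ (H k) x ∧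
            |fderiv ℝ (H k) x (w : sphere (0 : E) 1)| ≤ K * η) →
          ∃ j : ℕ, x ∈ lineSlopeSet H (w : sphere (0 : E) 1) (2 * (K * η)) (1 / (j + 1)) :=
        ae_all_iff.2 fun w => ae_exists_mem_lineSlopeSet _ hH _ hKη
      suffices ∀ᵐ x ∂(μH[N] : Measure E), x ∈ B → x ∈ ⋃ i, P i by
        rw [ae_iff] at this
        convert! this using 2
        ext x
        simp
      filter_upwards [hslope, hker] with x hx1 hx2 hxB
      obtain ⟨hdiff, v, hv, hv0⟩ := hx2 hxB
      obtain ⟨w, hwW, hwv⟩ := hWd.exists_dist_lt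
        (⟨v, by simpa using hv⟩ : sphere (0 : E) 1) hη
      obtain ⟨j, hj⟩ := hx1 ⟨w, hwW⟩ fun k => ⟨hdiff k, by
        have h1 : fderiv ℝ (H k) x w = fderiv ℝ (H k) x (w - v) := by
          rw [map_sub, hv0, sub_zero]
        rw [h1, ← Real.norm_eq_abs]
        refine ((fderiv ℝ (H k) x).le_opNorm _).trans ?_
        refine mul_le_mul (norm_fderiv_le_of_lipschitz ℝ (hH k)) ?_ (norm_nonneg _) K.2
        rw [← dist_eq_norm, dist_comm]
        exact hwv.le⟩
      obtain ⟨q, hqQ, hq⟩ := hQd.exists_dist_lt x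
        (by positivity : (0 : ℝ) < 1 / (j + 1) / 2)
      exact mem_iUnion.2 ⟨⟨⟨w, hwW⟩, j, ⟨q, hqQ⟩⟩, ⟨hxB, hj⟩, hq⟩
    have hmain := measure_image_iUnion_le_of_forall_subset (μ := (μH[N] : Measure E))
      (ν := (μH[N] : Measure Y)) (h := h) hP
      (c := ((3 * K : ℝ≥0) : ℝ≥0∞) ^ (N : ℝ) * ENNReal.ofReal η) (fun i s hsi =>
        hausdorffMeasure_image_le_of_subset_lineSlopeSet hH
          (fun x hx y hy => hs x (hsi hx).1.1 y (hsi hy).1.1)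
          (by simp) hη (fun x hx => (hsi hx).1.2)
          (fun x hx => (hsi hx).2))
    have hnull' : μH[N] (h '' (B \ ⋃ i, P i)) = 0 :=
      (hlip.mono sdiff_subset).hausdorffMeasure_image_eq_zero (by positivity) hnull
    calc μH[N] (h '' B) ≤ μH[N] (h '' ⋃ i, P i) + μH[N] (h '' (B \ ⋃ i, P i)) := by
          rw [← union_sdiff_cancel hPB, image_union, union_sdiff_cancel hPB]
          exact measure_union_le _ _
      _ ≤ ((3 * K : ℝ≥0) : ℝ≥0∞) ^ (N : ℝ) * ENNReal.ofReal η * μH[N] B := by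
          rw [hnull', add_zero]
          exact hmain.trans (mul_le_mul_right (measure_mono hPB) _)
      _ = _ := by ring
  have hc : ((3 * K : ℝ≥0) : ℝ≥0∞) ^ (N : ℝ) * μH[N] B ≠ ∞ :=
    ENNReal.mul_ne_top (ENNReal.rpow_ne_top_of_nonneg (by positivity) ENNReal.coe_ne_top) hB'
  have hlim : Tendsto (fun η : ℝ => (((3 * K : ℝ≥0) : ℝ≥0∞) ^ (N : ℝ) * μH[N] B) *
      ENNReal.ofReal η) (𝓝[>] 0) (𝓝 0) := by
    have h0 : Tendsto ENNReal.ofReal (𝓝[>] 0) (𝓝 0) := by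
      simpa using (ENNReal.continuous_ofReal.tendsto 0).mono_left nhdsWithin_le_nhds
    simpa using ENNReal.Tendsto.const_mul h0 (Or.inr hc)
  refine nonpos_iff_eq_zero.1 (ge_of_tendsto hlim ?_)
  filter_upwards [self_mem_nhdsWithin] with η hη using key η hη

end Collapse

section Projection

variable {n : ℕ}

/-- The continuous linear map into Euclidean space with given coordinate functionals. -/
def euclideanPi {E : Type*} [NormedAddCommGroup E] [NormedSpace ℝ E] (φ : Fin n → E →L[ℝ] ℝ) :
    E →L[ℝ] EuclideanSpace ℝ (Fin n) :=
  ((EuclideanSpace.equiv (Fin n) ℝ).symm : (Fin n → ℝ) →L[ℝ] EuclideanSpace ℝ (Fin n)) ∘L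
    ContinuousLinearMap.pi φ

theorem euclideanPi_apply {E : Type*} [NormedAddCommGroup E] [NormedSpace ℝ E]
    (φ : Fin n → E →L[ℝ] ℝ) (v : E) (i : Fin n) : euclideanPi φ v i = φ i v :=
  rfl

theorem exists_norm_eq_one_forall_apply_eq_zero {φ : ℕ → EuclideanSpace ℝ (Fin n) →L[ℝ] ℝ}
    (hφ : ∀ κ : Fin n → ℕ, (euclideanPi fun i => φ (κ i)).det = 0) :
    ∃ v : EuclideanSpace ℝ (Fin n), ‖v‖ = 1 ∧ ∀ k, φ k v = 0 := by
  let ψ : ℕ → Module.Dual ℝ (EuclideanSpace ℝ (Fin n)) := fun k => φ k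
  obtain ⟨ι, a, -, hspan, hli⟩ := exists_linearIndependent' ℝ ψ
  have := hli.finite
  have := Fintype.ofFinite ι
  have hcard : Fintype.card ι ≤ Fintype.card (Fin n) := by
    have := hli.fintype_card_le_finrank
    rwa [Subspace.dual_finrank_eq, finrank_euclideanSpace] at this
  obtain ⟨e⟩ := Function.Embedding.nonempty_of_card_le hcard
  obtain ⟨v, hv, hv0⟩ := Submodule.exists_mem_ne_zero_of_ne_bot
    (LinearMap.bot_lt_ker_of_det_eq_zero (hφ (Function.extend e a fun _ => 0))).ne'
  have hva : ∀ i, ψ (a i) v = 0 := fun i => by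
    have h1 := congrArg (fun z : EuclideanSpace ℝ (Fin n) => z (e i)) (LinearMap.mem_ker.1 hv)
    simp only [ContinuousLinearMap.coe_coe, euclideanPi_apply, e.injective.extend_apply] at h1
    exact h1
  have hker : Submodule.span ℝ (range ψ) ≤ LinearMap.ker (Module.Dual.eval ℝ _ v) := by
    rw [← hspan, Submodule.span_le]
    rintro _ ⟨i, rfl⟩
    exact hva i
  refine ⟨‖v‖⁻¹ • v, norm_smul_inv_norm hv0, fun k => ?_⟩
  have : ψ k v = 0 := hker (Submodule.subset_span (mem_range_self k))
  rw [map_smul]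
  simp only [ψ, ContinuousLinearMap.coe_coe] at this
  rw [this, smul_zero]

theorem isAddHaarMeasure_hausdorffMeasure_euclideanSpace :
    (μH[(n : ℝ)] : Measure (EuclideanSpace ℝ (Fin n))).IsAddHaarMeasure := by
  simpa using isAddHaarMeasure_hausdorffMeasure (E := EuclideanSpace ℝ (Fin n))

variable {Y : Type*} [MetricSpace Y]

/-- The distance functions from a dense sequence of points in the image of a Lipschitz map can be
extended to Lipschitz functions; they control the distance in the image. -/
theorem LipschitzOnWith.exists_lipschitzWith_dist {Z : Type*} [PseudoMetricSpace Z]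
    [SecondCountableTopology Z] {h : Z → Y} {K : ℝ≥0} {B : Set Z} (hh : LipschitzOnWith K h B)
    (hne : B.Nonempty) :
    ∃ (y : ℕ → Y) (H : ℕ → Z → ℝ), (∀ k, LipschitzWith K (H k)) ∧
      (∀ k, ∀ x ∈ B, H k x = dist (h x) (y k)) ∧
      ∀ x ∈ B, ∀ z ∈ B, ∀ c, (∀ k, |H k x - H k z| ≤ c) → dist (h x) (h z) ≤ c := by
  have := hne.to_subtype
  let p : ℕ → B := TopologicalSpace.denseSeq B
  have hlip : ∀ k, LipschitzOnWith K (fun x => dist (h x) (h (p k))) B := fun k => by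
    have := (LipschitzWith.dist_left (h (p k))).comp_lipschitzOnWith hh
    rwa [one_mul] at this
  choose H hH hHeq using fun k => (hlip k).extend_real
  refine ⟨fun k => h (p k), H, hH, fun k x hx => (hHeq k hx).symm, fun x hx z hz c hc => ?_⟩
  refine le_of_forall_pos_le_add fun ε hε => ?_
  obtain ⟨k, hk⟩ := (TopologicalSpace.denseRange_denseSeq B).exists_dist_lt ⟨x, hx⟩
    (by positivity : 0 < ε / (2 * (K + 1)))
  have h1 : dist (h x) (h (p k)) ≤ K * dist x (p k) := hh.dist_le_mul x hx _ (p k).2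
  have h2 : dist x (p k) < ε / (2 * (K + 1)) := hk
  have h3 := hc k
  rw [← hHeq k hx, ← hHeq k hz, abs_le] at h3
  have h4 := dist_triangle_right (h x) (h z) (h (p k))
  have h5 : K * dist x (p k) ≤ ε / 2 := by
    calc K * dist x (p k) ≤ (K + 1) * (ε / (2 * (K + 1))) := by
          refine mul_le_mul (by simp) h2.le dist_nonneg (by positivity)
      _ = ε / 2 := by field_simp
  linarith [h3.1]

variable [MeasurableSpace Y] [BorelSpace Y]

/-- If a Lipschitz image of a piece of `ℝⁿ` has positive measure, then so does some Lipschitz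
projection of it to `ℝⁿ`. -/
theorem exists_lipschitzWith_hausdorffMeasure_image_ne_zero {h : EuclideanSpace ℝ (Fin n) → Y}
    {K : ℝ≥0} {B : Set (EuclideanSpace ℝ (Fin n))} (hB : MeasurableSet B)
    (hB' : μH[(n : ℝ)] B ≠ ∞) (hh : LipschitzOnWith K h B) (hpos : μH[(n : ℝ)] (h '' B) ≠ 0) :
    ∃ P : Y → EuclideanSpace ℝ (Fin n), (∃ C, LipschitzWith C P) ∧
      μH[(n : ℝ)] ((fun x => P (h x)) '' B) ≠ 0 := by
  by_contra! hcon
  refine hpos ?_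
  rcases B.eq_empty_or_nonempty with rfl | hne
  · simp
  have := isAddHaarMeasure_hausdorffMeasure_euclideanSpace (n := n)
  obtain ⟨y, H, hH, hHy, hs⟩ :=
    (hh.weaken (le_add_right le_rfl : K ≤ K + 1)).exists_lipschitzWith_dist hne
  have hdet : ∀ κ : Fin n → ℕ, μH[(n : ℝ)] {x | x ∈ B ∧ (∀ k, DifferentiableAt ℝ (H k) x) ∧
      (euclideanPi fun i => fderiv ℝ (H (κ i)) x).det ≠ 0} = 0 := by
    intro κ
    let P : Y → EuclideanSpace ℝ (Fin n) := fun z => WithLp.toLp 2 fun i => dist z (y (κ i))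
    have hP : LipschitzWith _ P := (PiLp.lipschitzWith_toLp 2 fun _ : Fin n => ℝ).comp
      (LipschitzWith.of_dist_le_mul (K := 1) fun z z' => by
        rw [dist_pi_le_iff (by positivity)]
        exact fun i => (LipschitzWith.dist_left (y (κ i))).dist_le_mul z z')
    refine addHaar_eq_zero_of_image_eq_zero_of_det_ne_zero _
      (f := fun x => WithLp.toLp 2 fun i => H (κ i) x)
      (f' := fun x => euclideanPi fun i => fderiv ℝ (H (κ i)) x) (fun x hx => ?_)
      (fun x hx => hx.2.2) (measure_mono_null ?_ (hcon P ⟨_, hP⟩))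
    · exact hasFDerivWithinAt_euclidean.2 fun i => (hx.2.1 (κ i)).hasFDerivAt.hasFDerivWithinAt
    · rintro _ ⟨x, hx, rfl⟩
      refine ⟨x, hx.1, ?_⟩
      simp only [P, hHy _ x hx.1]
  have hker : ∀ᵐ x ∂(μH[(n : ℝ)] : Measure (EuclideanSpace ℝ (Fin n))), x ∈ B →
      (∀ k, DifferentiableAt ℝ (H k) x) ∧
        ∃ v : EuclideanSpace ℝ (Fin n), ‖v‖ = 1 ∧ ∀ k, fderiv ℝ (H k) x v = 0 := by
    filter_upwards [ae_all_iff.2 fun k => (hH k).ae_differentiableAt,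
      ae_all_iff.2 fun κ => compl_mem_ae_iff.2 (hdet κ)] with x hx1 hx2 hxB
    refine ⟨hx1, exists_norm_eq_one_forall_apply_eq_zero fun κ => ?_⟩
    by_contra h
    exact hx2 κ ⟨hxB, hx1, h⟩
  have hfin : Module.finrank ℝ (EuclideanSpace ℝ (Fin n)) = n := finrank_euclideanSpace_fin
  have := hausdorffMeasure_image_eq_zero_of_common_kernel (h := h) (by positivity) hH hB
    (by rwa [hfin]) hs (by rwa [hfin])
  rwa [hfin] at this

end Projection

theorem LipschitzOnWith.exists_extend_closure {V X : Type*} [PseudoMetricSpace V] [MetricSpace X]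
    [CompleteSpace X] {φ : V → X} {A : Set V} {K : ℝ≥0} (hφ : LipschitzOnWith K φ A) :
    ∃ φ' : V → X, LipschitzOnWith K φ' (closure A) ∧ EqOn φ' φ A := by
  have hlim : ∀ x ∈ closure A, ∃ y, Tendsto φ (𝓝[A] x) (𝓝 y) := fun x hx => by
    have := mem_closure_iff_nhdsWithin_neBot.1 hx
    have hc : Cauchy (𝓝[A] x) := cauchy_nhds.mono nhdsWithin_le_nhds
    exact CompleteSpace.complete (hc.map_of_le hφ.uniformContinuousOn inf_le_right)
  have heq : EqOn (extendFrom A φ) φ A := extendFrom_extends hφ.continuousOn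
  refine ⟨extendFrom A φ, LipschitzOnWith.closure (continuousOn_extendFrom subset_rfl hlim) ?_, heq⟩
  intro x hx y hy
  rw [heq hx, heq hy]
  exact hφ hx hy

/-- A rectifiable set whose image under a Lipschitz map `f` has positive measure contains the image
of a Borel piece of `ℝⁿ` under a Lipschitz map whose composition with `f` has image of positive
measure. -/
theorem IsRectifiable.exists_measurableSet_mapsTo {X : Type*} [MetricSpace X] [CompleteSpace X]
    [MeasurableSpace X] [BorelSpace X] {n : ℕ} {S : Set X} (hS : IsRectifiable n S)
    {Y : Type*} [MetricSpace Y] [MeasurableSpace Y] [BorelSpace Y] {f : X → Y} {L : ℝ≥0}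
    (hf : LipschitzOnWith L f S) (hpos : μH[(n : ℝ)] (f '' S) ≠ 0) :
    ∃ (B : Set (EuclideanSpace ℝ (Fin n))) (φ : EuclideanSpace ℝ (Fin n) → X) (K : ℝ≥0),
      MeasurableSet B ∧ μH[(n : ℝ)] B ≠ ∞ ∧ LipschitzOnWith K φ B ∧ MapsTo φ B S ∧
        μH[(n : ℝ)] ((f ∘ φ) '' B) ≠ 0 := by
  classical
  obtain ⟨hmeas, A, ψ, hψ, hcover⟩ := hS
  obtain ⟨S', hS'S, hS', hae⟩ := hmeas.exists_measurable_subset_ae_eq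
  choose K hK using hψ
  choose φ hφ hφψ using fun i => (hK i).exists_extend_closure
  have := isAddHaarMeasure_hausdorffMeasure_euclideanSpace (n := n)
  let B : ℕ → ℕ → Set (EuclideanSpace ℝ (Fin n)) := fun i m =>
    (closure (A i) ∩ closedBall 0 m) ∩ φ i ⁻¹' S'
  by_contra! hcon
  have hnull : ∀ i m, μH[(n : ℝ)] ((f ∘ φ i) '' B i m) = 0 := fun i m => by
    refine hcon _ (φ i) (K i) ?_ ?_ ((hφ i).mono fun x hx => hx.1.1) (fun x hx => hS'S hx.2)
    · have hC : MeasurableSet (closure (A i) ∩ closedBall 0 (m : ℝ)) :=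
        measurableSet_closure.inter measurableSet_closedBall
      have hpw : Measurable
          ((closure (A i) ∩ closedBall 0 (m : ℝ)).piecewise (φ i) fun _ => φ i 0) := by
        exact ((hφ i).continuousOn.mono inter_subset_left).measurable_piecewise
          continuousOn_const hC
      convert hC.inter (hpw hS') using 1
      ext x
      simp +contextual [B, and_congr_right_iff, piecewise]
    · exact measure_ne_top_of_subset (fun x hx => hx.1.2)
        (isCompact_closedBall (0 : EuclideanSpace ℝ (Fin n)) m).measure_ne_top
  have hsub : f '' S ⊆ f '' (S \ S') ∪ f '' (S \ ⋃ i, ψ i '' A i) ∪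
      ⋃ i, ⋃ m, (f ∘ φ i) '' B i m := by
    rintro _ ⟨x, hx, rfl⟩
    by_cases hx1 : x ∈ S'
    · by_cases hx2 : x ∈ ⋃ i, ψ i '' A i
      · obtain ⟨i, a, ha, rfl⟩ := mem_iUnion.1 hx2
        obtain ⟨m, hm⟩ := exists_nat_ge ‖a‖
        rw [← hφψ i ha] at hx1 ⊢
        exact Or.inr (mem_iUnion₂.2 ⟨i, m, a, ⟨⟨subset_closure ha, by simpa using hm⟩, hx1⟩, rfl⟩)
      · exact Or.inl (Or.inr (mem_image_of_mem f ⟨hx, hx2⟩))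
    · exact Or.inl (Or.inl (mem_image_of_mem f ⟨hx, hx1⟩))
  refine hpos (measure_mono_null hsub (measure_union_null (measure_union_null ?_ ?_)
    (measure_iUnion_null fun i => measure_iUnion_null fun m => hnull i m)))
  · exact (hf.mono sdiff_subset).hausdorffMeasure_image_eq_zero (by positivity)
      (ae_le_set.1 hae.symm.le)
  · exact (hf.mono sdiff_subset).hausdorffMeasure_image_eq_zero (by positivity) hcover

theorem stmt8 {X : Type*} [MetricSpace X] [CompleteSpace X] [MeasurableSpace X] [BorelSpace X]
    (n : ℕ) (hn : 1 ≤ n) (S : Set X) (hrect : IsRectifiable n S)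
    (L : ℝ≥0) (hL : 0 < L)
    (Y : Type*) [MetricSpace Y] [MeasurableSpace Y] [BorelSpace Y]
    (f : X → Y) (hf : LipschitzWith L f) (hpos : 0 < μH[(n : ℝ)] (f '' S)) :
    ∃ ε : ℝ, 0 < ε ∧ ∀ g : X → Y, LipschitzOnWith L g S →
      (∀ x ∈ S, dist (f x) (g x) < ε) → 0 < μH[(n : ℝ)] (g '' S) := by
  obtain ⟨B, φ, K, hB, hB', hφ, hBS, hfφ⟩ :=
    hrect.exists_measurableSet_mapsTo hf.lipschitzOnWith hpos.ne'
  obtain ⟨P, ⟨C, hP⟩, hPfφ⟩ := exists_lipschitzWith_hausdorffMeasure_image_ne_zero hB hB'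
    (hf.comp_lipschitzOnWith hφ) hfφ
  have := isAddHaarMeasure_hausdorffMeasure_euclideanSpace (n := n)
  obtain ⟨ε, hε, hG⟩ := exists_forall_dist_lt_addHaar_image_pos μH[(n : ℝ)] hB
    (hP.comp_lipschitzOnWith (hf.comp_lipschitzOnWith hφ)) hPfφ
  refine ⟨ε / (C + 1), by positivity, fun g hg hfg => pos_iff_ne_zero.2 fun h0 => ?_⟩
  refine hG (P ∘ g ∘ φ) (hP.comp_lipschitzOnWith (hg.comp hφ hBS)) (fun x hx => ?_) ?_
  · have h1 := hfg (φ x) (hBS hx)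
    calc dist (P (f (φ x))) (P (g (φ x))) ≤ C * dist (f (φ x)) (g (φ x)) := hP.dist_le_mul _ _
      _ ≤ (C + 1) * dist (f (φ x)) (g (φ x)) := by gcongr; simp
      _ < (C + 1) * (ε / (C + 1)) := by gcongr
      _ = ε := by field_simp
  · have h1 : (P ∘ g ∘ φ) '' B ⊆ P '' (g '' S) := by
      rintro _ ⟨x, hx, rfl⟩
      exact ⟨g (φ x), mem_image_of_mem g (hBS hx), rfl⟩
    exact measure_mono_null h1
      (hP.lipschitzOnWith.hausdorffMeasure_image_eq_zero (by positivity) h0)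
end
end

section
/- Let n, m be positive integers with m ≥ n, let A ⊆ ℝ^n be a Borel set with L^n(A) > 0, and let f : A → ℝ^m be Lipschitz. For any ε > 0 there exists a bounded Lipschitz map T* : ℝ^n → ℝ^m with Lip(T*) < ε and sup_{x ∈ ℝ^n} ‖T*(x)‖ < ε such that the map f* := f + T* (restricted to A) satisfies H^n(f*(A)) > 0. -/
open MeasureTheory Metric Set Filter
open scoped NNReal ENNReal Topology

noncomputable section

/-- A map that is approximated well enough by an injective linear map is antilipschitz. -/
lemma exists_approximatesLinearOn_antilipschitz {E F : Type*}
    [NormedAddCommGroup E] [NormedSpace ℝ E] [FiniteDimensional ℝ E]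
    [NormedAddCommGroup F] [NormedSpace ℝ F] (L : E →L[ℝ] F) :
    ∃ r : ℝ≥0, r ≠ 0 ∧ (Function.Injective L → ∀ (g : E → F) (s : Set E),
      ApproximatesLinearOn g L s r → ∃ K : ℝ≥0, AntilipschitzWith K (s.domRestrict g)) := by
  by_cases hL : Function.Injective L
  · obtain ⟨K, hK, hKL⟩ := (L : E →ₗ[ℝ] F).exists_antilipschitzWith (LinearMap.ker_eq_bot.2 hL)
    have hK' : K⁻¹ ≠ 0 := (inv_pos.2 hK).ne'
    refine ⟨K⁻¹ / 2, div_ne_zero hK' two_ne_zero, fun _ g s hg ↦ ⟨(K⁻¹ - K⁻¹ / 2)⁻¹, ?_⟩⟩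
    convert! (AntilipschitzWith.domRestrict hKL s).add_lipschitzWith hg.lipschitz_sub
      (NNReal.half_lt_self hK')
    simp [domRestrict]
  · exact ⟨1, one_ne_zero, fun h ↦ absurd h hL⟩

/-- A map with injective derivative on a set `s` of positive Hausdorff measure maps `s` to a set
of positive Hausdorff measure. -/
lemma hausdorffMeasure_image_pos_of_injective_fderivWithin {E F : Type*}
    [NormedAddCommGroup E] [NormedSpace ℝ E] [FiniteDimensional ℝ E]
    [MeasurableSpace E] [BorelSpace E]
    [NormedAddCommGroup F] [NormedSpace ℝ F] [FiniteDimensional ℝ F]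
    [MeasurableSpace F] [BorelSpace F]
    {g : E → F} {s : Set E} {g' : E → E →L[ℝ] F} {d : ℝ} (hd : 0 ≤ d)
    (hg : ∀ x ∈ s, HasFDerivWithinAt g (g' x) s x)
    (hinj : ∀ x ∈ s, Function.Injective (g' x)) (hs : 0 < μH[d] s) :
    0 < μH[d] (g '' s) := by
  choose r hr0 hr using exists_approximatesLinearOn_antilipschitz (E := E) (F := F)
  obtain ⟨t, L, -, -, hst, happ, hL⟩ :=
    exists_partition_approximatesLinearOn_of_hasFDerivWithinAt g s g' hg r hr0
  have hne : s.Nonempty := nonempty_of_measure_ne_zero hs.ne'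
  by_contra! h
  have hzero : μH[d] (g '' s) = 0 := le_antisymm h zero_le
  refine hs.ne' (measure_mono_null (t := ⋃ k, s ∩ t k) ?_ (measure_iUnion_null fun k ↦ ?_))
  · rw [← inter_iUnion]
    exact subset_inter subset_rfl hst
  obtain ⟨y, hy, hLy⟩ := hL hne k
  obtain ⟨K, hK⟩ := hr (L k) (hLy ▸ hinj y hy) g _ (happ k)
  have hle := hK.le_hausdorffMeasure_image hd univ
  rw [image_univ, range_domRestrict, measure_mono_null (image_mono inter_subset_left) hzero,
    mul_zero] at hle
  have hcoe := (isometry_subtype_coe (s := s ∩ t k)).hausdorffMeasure_image (d := d) (.inl hd) univ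
  rw [image_univ, Subtype.range_coe] at hcoe
  rw [hcoe]
  exact le_antisymm hle zero_le

/-- The coordinatewise truncation of a vector at height `R`. -/
def clampVec {n : ℕ} (R : ℝ) (x : EuclideanSpace ℝ (Fin n)) : EuclideanSpace ℝ (Fin n) :=
  WithLp.toLp 2 fun i ↦ max (-R) (min R (x i))

lemma lipschitzWith_clampVec {n : ℕ} (R : ℝ) : LipschitzWith 1 (clampVec (n := n) R) := by
  refine LipschitzWith.mk_one fun x y ↦ ?_
  rw [EuclideanSpace.dist_eq, EuclideanSpace.dist_eq]
  refine Real.sqrt_le_sqrt (Finset.sum_le_sum fun i _ ↦ ?_)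
  gcongr
  exact ((LipschitzWith.id.const_min R).const_max (-R)).dist_le_mul (x i) (y i) |>.trans_eq
    (by simp)

lemma clampVec_eq_self {n : ℕ} {R : ℝ} {x : EuclideanSpace ℝ (Fin n)} (hx : ‖x‖ ≤ R) :
    clampVec R x = x := by
  ext i
  have := abs_le.1 ((PiLp.norm_apply_le x i).trans hx)
  simp [clampVec, this.1, this.2]

lemma exists_norm_clampVec_le (n : ℕ) (R : ℝ) :
    ∃ B : ℝ, ∀ x : EuclideanSpace ℝ (Fin n), ‖clampVec R x‖ ≤ B := by
  refine ⟨√(∑ _i : Fin n, |R| ^ 2), fun x ↦ ?_⟩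
  rw [EuclideanSpace.norm_eq]
  refine Real.sqrt_le_sqrt (Finset.sum_le_sum fun i _ ↦ ?_)
  gcongr
  refine abs_le.2 ⟨(neg_le_neg (le_abs_self R)).trans (le_max_left _ _), ?_⟩
  exact max_le (neg_le_abs R) ((min_le_left _ _).trans (le_abs_self R))

lemma exists_leftInverse_euclideanSpace {n m : ℕ} (hm : n ≤ m) :
    ∃ (ι : EuclideanSpace ℝ (Fin n) →L[ℝ] EuclideanSpace ℝ (Fin m))
      (P : EuclideanSpace ℝ (Fin m) →L[ℝ] EuclideanSpace ℝ (Fin n)), ∀ x, P (ι x) = x := by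
  let P : EuclideanSpace ℝ (Fin m) →ₗ[ℝ] EuclideanSpace ℝ (Fin n) :=
    (WithLp.linearEquiv 2 ℝ (Fin n → ℝ)).symm.toLinearMap ∘ₗ
      LinearMap.funLeft ℝ ℝ (Fin.castLE hm) ∘ₗ (WithLp.linearEquiv 2 ℝ (Fin m → ℝ)).toLinearMap
  have hP : Function.Surjective P :=
    (WithLp.linearEquiv 2 ℝ (Fin n → ℝ)).symm.surjective.comp
      ((LinearMap.funLeft_surjective_of_injective ℝ ℝ _ (Fin.castLE_injective hm)).comp
        (WithLp.linearEquiv 2 ℝ (Fin m → ℝ)).surjective)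
  obtain ⟨ι, hι⟩ := P.exists_rightInverse_of_surjective (LinearMap.range_eq_top.2 hP)
  exact ⟨ι.toContinuousLinearMap, P.toContinuousLinearMap, fun x ↦ LinearMap.congr_fun hι x⟩

/-- If `ι` has a left inverse, then `L + t k • ι` is injective for some `k`, for any sequence
`t` of distinct scalars. -/
lemma exists_injective_add_smul {E F : Type*}
    [NormedAddCommGroup E] [NormedSpace ℝ E] [FiniteDimensional ℝ E]
    [NormedAddCommGroup F] [NormedSpace ℝ F] (L ι : E →L[ℝ] F) (P : F →L[ℝ] E)
    (hP : ∀ x, P (ι x) = x) {t : ℕ → ℝ} (ht : Function.Injective t) :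
    ∃ k, Function.Injective (L + t k • ι) := by
  by_contra! h
  let M : Module.End ℝ E := (P ∘L L).toLinearMap
  refine Set.infinite_range_of_injective (neg_injective.comp ht)
    ((Module.End.finite_hasEigenvalue M).subset ?_)
  rintro _ ⟨k, rfl⟩
  have hk := h k
  rw [injective_iff_map_eq_zero] at hk
  push Not at hk
  obtain ⟨x, hx, hx0⟩ := hk
  refine Module.End.hasEigenvalue_of_hasEigenvector (x := x)
    ⟨Module.End.mem_eigenspace_iff.2 ?_, hx0⟩
  have := congrArg P hx
  simp only [add_apply, smul_apply, map_add, map_smul, hP,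
    map_zero] at this
  simpa [M] using eq_neg_of_add_eq_zero_left this

theorem stmt12 (n m : ℕ) (hn : 1 ≤ n) (hm : n ≤ m)
    (A : Set (EuclideanSpace ℝ (Fin n))) (hA : MeasurableSet A) (hApos : 0 < volume A)
    (f : EuclideanSpace ℝ (Fin n) → EuclideanSpace ℝ (Fin m))
    (hf : ∃ K : ℝ≥0, LipschitzOnWith K f A)
    (ε : ℝ) (hε : 0 < ε) :
    ∃ T : EuclideanSpace ℝ (Fin n) → EuclideanSpace ℝ (Fin m),
      (∃ K : ℝ≥0, (K : ℝ) < ε ∧ LipschitzWith K T) ∧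
      (∀ x, ‖T x‖ < ε) ∧
      0 < μH[(n : ℝ)] ((fun x => f x + T x) '' A) := by
  obtain ⟨C, hC⟩ := hf
  obtain ⟨ι, P, hP⟩ := exists_leftInverse_euclideanSpace hm
  have : (μH[(n : ℝ)] : Measure (EuclideanSpace ℝ (Fin n))).IsAddHaarMeasure := by
    have h := isAddHaarMeasure_hausdorffMeasure (E := EuclideanSpace ℝ (Fin n))
    rwa [finrank_euclideanSpace_fin] at h
  have hHpos : μH[(n : ℝ)] A ≠ 0 := fun h ↦
    hApos.ne' (Measure.absolutelyContinuous_isAddHaarMeasure volume μH[(n : ℝ)] h)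
  obtain ⟨R, hR⟩ : ∃ R : ℕ, 0 < μH[(n : ℝ)] (A ∩ ball 0 R) := by
    apply exists_measure_pos_of_not_measure_iUnion_null
    rwa [← inter_iUnion, iUnion_ball_nat, inter_univ]
  obtain ⟨B, hB⟩ := exists_norm_clampVec_le n R
  set δ : ℝ := ε / (‖ι‖ * (1 + |B|) + 1) with hδ
  have hδ0 : 0 < δ := by positivity
  let t : ℕ → ℝ := fun k ↦ δ / (k + 1)
  have ht0 (k : ℕ) : 0 < t k := by positivity
  have htδ (k : ℕ) : t k ≤ δ := div_le_self hδ0.le (by simp)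
  have htε (k : ℕ) {b : ℝ} (hb : b ≤ 1 + |B|) : t k * (‖ι‖ * b) < ε := by
    calc t k * (‖ι‖ * b) ≤ t k * (‖ι‖ * (1 + |B|)) := by have := (ht0 k).le; gcongr
      _ ≤ δ * (‖ι‖ * (1 + |B|)) := by gcongr; exact htδ k
      _ < δ * (‖ι‖ * (1 + |B|) + 1) := by gcongr; exact lt_add_one _
      _ = ε := div_mul_cancel₀ _ (by positivity)
  have htinj : Function.Injective t := fun i j hij ↦ by
    simpa [t, div_eq_mul_inv, hδ0.ne'] using hij
  let D (k : ℕ) : Set (EuclideanSpace ℝ (Fin n)) := {x ∈ A ∩ ball 0 R |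
    DifferentiableWithinAt ℝ f A x ∧ Function.Injective (fderivWithin ℝ f A x + t k • ι)}
  obtain ⟨k, hk⟩ : ∃ k, 0 < μH[(n : ℝ)] (D k) := by
    apply exists_measure_pos_of_not_measure_iUnion_null
    refine fun h ↦ hR.ne' (measure_mono_null_ae ?_ h)
    filter_upwards [hC.ae_differentiableWithinAt_of_mem (μ := μH[(n : ℝ)])] with x hx hxA
    obtain ⟨k, hk⟩ := exists_injective_add_smul (fderivWithin ℝ f A x) ι P hP htinj
    exact mem_iUnion.2 ⟨k, hxA, hx hxA.1, hk⟩
  have hDA : D k ⊆ A := fun x hx ↦ hx.1.1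
  have hclamp {x} (hx : x ∈ D k) : t k • ι (clampVec R x) = t k • ι x := by
    rw [clampVec_eq_self (mem_ball_zero_iff.1 hx.1.2).le]
  refine ⟨fun x ↦ t k • ι (clampVec R x), ⟨‖t k‖₊ * (‖ι‖₊ * 1), ?_, ?_⟩, fun x ↦ ?_, ?_⟩
  · simpa [abs_of_pos (ht0 k)] using htε k (b := 1) (by simp)
  · exact (lipschitzWith_smul (t k)).comp (ι.lipschitz.comp (lipschitzWith_clampVec _))
  · rw [norm_smul, Real.norm_of_nonneg (ht0 k).le]
    refine lt_of_le_of_lt ?_ (htε k (b := B) (by linarith [le_abs_self B]))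
    have := (ht0 k).le
    gcongr
    exact ι.le_opNorm_of_le (hB x)
  · refine (hausdorffMeasure_image_pos_of_injective_fderivWithin (Nat.cast_nonneg n)
      (g' := fun x ↦ fderivWithin ℝ f A x + t k • ι) (fun x hx ↦ ?_) (fun x hx ↦ hx.2.2)
      hk).trans_le (measure_mono (image_mono hDA))
    exact (hx.2.1.hasFDerivWithinAt.mono hDA).add
      ((t k • ι).hasFDerivWithinAt.congr (fun y hy ↦ hclamp hy) (hclamp hx))
end
end

section
/- Let X be a complete metric space, n ≥ 1 an integer, and S ⊆ X an n-rectifiable set with H^n(S) > 0. Let V be a finite-dimensional real Banach space with dim V ≥ n and L > 0. Then for any f ∈ Lip(X,V,L) and any ε > 0, there exists g ∈ Lip(X,V,L) with sup_{x∈X} ‖f(x) − g(x)‖ < ε and H^n(g(S)) > 0. -/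
open MeasureTheory Metric Set Filter
open scoped NNReal ENNReal Topology

noncomputable section

/-- `Lip(X,Y,L)`: the space of bounded `L`-Lipschitz functions `X → Y` with the
supremum distance. -/
def LipSpace (X Y : Type*) [MetricSpace X] [MetricSpace Y] (L : ℝ≥0) : Type _ :=
  {f : BoundedContinuousFunction X Y // LipschitzWith L ⇑f}

instance {X Y : Type*} [MetricSpace X] [MetricSpace Y] {L : ℝ≥0} :
    MetricSpace (LipSpace X Y L) :=
  inferInstanceAs (MetricSpace {f : BoundedContinuousFunction X Y // LipschitzWith L ⇑f})


open scoped RealInnerProductSpace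
open Module (finrank)

/-- At almost every point where all functions of a uniformly Lipschitz sequence on `ℝ` have
derivative at most `q`, their difference quotients are uniformly eventually at most `2 * q`. -/
lemma ae_exists_forall_abs_sub_le_of_deriv {g : ℕ → ℝ → ℝ} {C : ℝ≥0}
    (hg : ∀ j, LipschitzWith C (g j)) {q : ℝ} (hq : 0 < q) :
    ∀ᵐ t, (∀ j, |deriv (g j) t| ≤ q) →
      ∃ k : ℕ, ∀ s : ℝ, |s| ≤ 1 / (k + 1) → ∀ j, |g j (t + s) - g j t| ≤ 2 * q * |s| := by
  classical
  set P : Set ℝ := {t | ∀ j, |deriv (g j) t| ≤ q}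
  have hP : MeasurableSet P := by
    have : P = ⋂ j, {t | |deriv (g j) t| ≤ q} := by ext; simp [P]
    rw [this]
    exact MeasurableSet.iInter fun j ↦
      measurableSet_le (measurable_deriv (g j)).norm measurable_const
  set h : ℝ → ℝ := fun t ↦ Pᶜ.indicator (fun _ ↦ (C : ℝ)) t + q
  have hmeas : Measurable h := (measurable_const.indicator hP.compl).add_const q
  have hbound (t : ℝ) : ‖h t‖ ≤ C + q := by
    have h0 : 0 ≤ Pᶜ.indicator (fun _ ↦ (C : ℝ)) t := indicator_nonneg (fun _ _ ↦ C.2) t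
    have h1 : Pᶜ.indicator (fun _ ↦ (C : ℝ)) t ≤ C := indicator_le_self' (fun _ _ ↦ C.2) t
    rw [Real.norm_of_nonneg (by positivity)]
    simp only [h]
    linarith
  have hloc : LocallyIntegrable h volume :=
    (memLp_top_of_bound hmeas.aestronglyMeasurable (C + q) (.of_forall hbound)).locallyIntegrable
      le_top
  have hint (a b : ℝ) : IntervalIntegrable h volume a b :=
    intervalIntegrable_iff.mpr <|
      (hloc.integrableOn_isCompact isCompact_uIcc).mono_set uIoc_subset_uIcc
  have hdom (j : ℕ) (t : ℝ) : ‖deriv (g j) t‖ ≤ h t := by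
    by_cases ht : t ∈ P
    · simpa [h, ht] using ht j
    · have := norm_deriv_le_of_lipschitz (hg j) (x₀ := t)
      simp only [h, indicator_of_mem (show t ∈ Pᶜ from ht)]
      linarith
  filter_upwards [_root_.LocallyIntegrable.ae_hasDerivAt_integral hloc] with t ht htP
  have hd := ht 0
  have hqt : h t = q := by simp [h, show t ∈ P from htP]
  rw [hqt, hasDerivAt_iff_isLittleO_nhds_zero] at hd
  obtain ⟨δ, hδ, hball⟩ := Metric.eventually_nhds_iff.1 (hd.def hq)
  obtain ⟨k, hk⟩ := exists_nat_one_div_lt hδ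
  refine ⟨k, fun s hs j ↦ ?_⟩
  have hs' := hball (y := s) (by simpa using hs.trans_lt hk)
  rw [intervalIntegral.integral_interval_sub_left (hint _ _) (hint _ _)] at hs'
  have hac : AbsolutelyContinuousOnInterval (g j) t (t + s) :=
    ((hg j).lipschitzOnWith).absolutelyContinuousOnInterval
  rw [← hac.integral_deriv_eq_sub, ← Real.norm_eq_abs]
  refine (intervalIntegral.norm_integral_le_abs_of_norm_le
    (.of_forall fun x ↦ hdom j x) (hint _ _)).trans ?_
  rw [Real.norm_eq_abs, Real.norm_eq_abs, smul_eq_mul] at hs'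
  have := abs_sub_abs_le_abs_sub (∫ x in t..t + s, h x) (s * q)
  rw [abs_mul, abs_of_pos hq] at this
  linarith

/-- At almost every point where all functions of a uniformly Lipschitz sequence have derivative
at most `q` in direction `v`, their difference quotients in this direction are uniformly eventually
at most `2 * q`. -/
lemma ae_exists_forall_abs_sub_le_of_lineDeriv {E : Type*} [NormedAddCommGroup E]
    [NormedSpace ℝ E] [FiniteDimensional ℝ E] [MeasurableSpace E] [BorelSpace E]
    (μ : Measure E) [μ.IsAddHaarMeasure] {F : ℕ → E → ℝ} {K : ℝ≥0}
    (hF : ∀ j, LipschitzWith K (F j)) (v : E) {q : ℝ} (hq : 0 < q) :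
    ∀ᵐ x ∂μ, (∀ j, |lineDeriv ℝ (F j) x v| ≤ q) →
      ∃ k : ℕ, ∀ s : ℝ, |s| ≤ 1 / (k + 1) → ∀ j, |F j (x + s • v) - F j x| ≤ 2 * q * |s| := by
  let L : ℝ →L[ℝ] E := ContinuousLinearMap.smulRight (1 : ℝ →L[ℝ] ℝ) v
  have hcont (j : ℕ) : Continuous (F j) := (hF j).continuous
  refine ae_mem_of_ae_add_linearMap_mem L.toLinearMap volume μ (s := {x | _ → _}) ?_ fun p ↦ ?_
  · have h1 : MeasurableSet {x | ∀ j, |lineDeriv ℝ (F j) x v| ≤ q} := by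
      simp only [Set.ofPred_forall]
      exact MeasurableSet.iInter fun j ↦
        measurableSet_le (measurable_lineDeriv (hcont j)).norm measurable_const
    have h2 : MeasurableSet {x | ∃ k : ℕ, ∀ s : ℝ, |s| ≤ 1 / (k + 1) →
        ∀ j, |F j (x + s • v) - F j x| ≤ 2 * q * |s|} := by
      simp only [Set.ofPred_exists, Set.ofPred_forall]
      refine MeasurableSet.iUnion fun k ↦ IsClosed.measurableSet ?_
      exact isClosed_iInter fun s ↦ isClosed_iInter fun _ ↦ isClosed_iInter fun j ↦
        isClosed_le (by fun_prop) continuous_const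
    convert h1.compl.union h2 using 1
    ext x
    exact imp_iff_not_or
  · have hg (j : ℕ) : LipschitzWith (K * ‖L‖₊) fun t : ℝ ↦ F j (p + t • v) := by
      have := (hF j).comp ((LipschitzWith.const p).add L.lipschitz)
      rw [zero_add] at this
      exact this
    filter_upwards [ae_exists_forall_abs_sub_le_of_deriv hg hq] with t ht hd
    have hderiv (j : ℕ) : lineDeriv ℝ (F j) (p + L t) v = deriv (fun t ↦ F j (p + t • v)) t := by
      have : (fun s : ℝ ↦ F j (p + L t + s • v)) = fun s ↦ (fun t ↦ F j (p + t • v)) (t + s) := by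
        ext s; simp [L, add_smul, add_assoc]
      rw [lineDeriv, this, deriv_comp_const_add (f := fun t : ℝ ↦ F j (p + t • v)), add_zero]
    obtain ⟨k, hk⟩ := ht fun j ↦ by rw [← hderiv]; exact hd j
    refine ⟨k, fun s hs j ↦ ?_⟩
    simpa [L, add_smul, add_assoc] using hk s hs j

/-- A map that is almost constant in a direction `v` shrinks Hausdorff measure: the metric of the
target is controlled by the functions `F j`, which vary at most at rate `ε` along `v`. -/
lemma hausdorffMeasure_image_le_of_contracted_direction {E X : Type*} [NormedAddCommGroup E]
    [InnerProductSpace ℝ E] [FiniteDimensional ℝ E] [MeasurableSpace E] [BorelSpace E]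
    [MetricSpace X] [MeasurableSpace X] [BorelSpace X] {n : ℕ}
    [(μH[(n : ℝ)] : Measure E).IsAddHaarMeasure] {γ : E → X} {S : Set E} {F : ℕ → E → ℝ} {K : ℝ≥0}
    (hF : ∀ j, LipschitzWith K (F j))
    (hγ : ∀ x ∈ S, ∀ y ∈ S, ∀ C, (∀ j, |F j x - F j y| ≤ C) → dist (γ x) (γ y) ≤ C)
    {v : E} (hv : ‖v‖ = 1) {ε : ℝ} (hε : 0 < ε)
    (hs : ∀ x ∈ S, ∀ y ∈ S, ∀ j, |F j (x + ⟪v, y - x⟫ • v) - F j x| ≤ ε * |⟪v, y - x⟫|) :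
    μH[(n : ℝ)] (γ '' S) ≤
      ((1 + K : ℝ≥0) : ℝ≥0∞) ^ n * ENNReal.ofReal ε * μH[(n : ℝ)] S := by
  let T : E →ₗ[ℝ] E := LinearMap.transvection ((ε - 1) • (innerₗ E v)) v
  have hT (x : E) : T x = x + ((ε - 1) * ⟪v, x⟫) • v := by
    simp [T, LinearMap.transvection.apply]
  have hdet : LinearMap.det T = ε := by
    simp [T, hv]
  let T' : E ≃ₗ[ℝ] E := T.equivOfDetNeZero (by rw [hdet]; exact hε.ne')
  have hT' (x : E) : T' x = T x := rfl
  have himage : γ '' S = (γ ∘ T'.symm) '' (T '' S) := by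
    rw [← image_comp]
    refine image_congr fun x _ ↦ ?_
    simp [← hT']
  have hlip : LipschitzOnWith (1 + K) (γ ∘ T'.symm) (T '' S) := by
    refine LipschitzOnWith.of_dist_le_mul ?_
    rintro _ ⟨x, hx, rfl⟩ _ ⟨y, hy, rfl⟩
    simp only [← hT', Function.comp_apply, LinearEquiv.symm_apply_apply]
    set a := ⟪v, y - x⟫ with ha
    set w := y - x - a • v with hw
    have hvw : ⟪v, w⟫ = 0 := by
      simp [hw, inner_sub_right, inner_smul_right, hv, ha]
    have hdec : T (y - x) = w + (ε * a) • v := by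
      rw [hT, hw, ← ha]; module
    have hnorm : ‖T (y - x)‖ ^ 2 = ‖w‖ ^ 2 + (ε * |a|) ^ 2 := by
      rw [hdec, norm_add_sq_real, inner_smul_right, real_inner_comm, hvw, norm_smul, hv]
      simp [mul_pow]
    have h1 : ‖w‖ ≤ ‖T (y - x)‖ :=
      le_of_sq_le_sq (by rw [hnorm]; nlinarith [sq_nonneg (ε * |a|)]) (norm_nonneg _)
    have h2 : ε * |a| ≤ ‖T (y - x)‖ :=
      le_of_sq_le_sq (by rw [hnorm]; nlinarith [sq_nonneg ‖w‖]) (norm_nonneg _)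
    have hdist : dist (T' x) (T' y) = ‖T (y - x)‖ := by
      rw [dist_comm, dist_eq_norm, hT', hT', map_sub]
    rw [hdist]
    refine hγ x hx y hy _ fun j ↦ ?_
    have h3 := hs x hx y hy j
    rw [← ha] at h3
    have h4 := (hF j).dist_le_mul (x + a • v) y
    have h5 : dist (x + a • v) y = ‖w‖ := by
      rw [dist_comm, dist_eq_norm, hw, sub_sub]
    rw [h5, Real.dist_eq] at h4
    have h6 := abs_sub_le (F j x) (F j (x + a • v)) (F j y)
    rw [abs_sub_comm (F j x) (F j (x + a • v))] at h6
    have h7 : K * ‖w‖ ≤ K * ‖T (y - x)‖ := by gcongr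
    push_cast
    linarith
  rw [himage]
  refine (hlip.hausdorffMeasure_image_le (Nat.cast_nonneg n)).trans ?_
  rw [Measure.addHaar_image_linearMap, hdet, abs_of_pos hε, ENNReal.rpow_natCast, mul_assoc]

/-- A local comparison between the measure of a set and that of its image holds globally if the
pieces on which it holds are measurable. -/
lemma measure_image_le_of_countable_cover {α β ι : Type*} [MeasurableSpace α] [MeasurableSpace β]
    [Countable ι] {μ : Measure α} {ν : Measure β} {γ : α → β} {P : ι → Set α}
    (hP : ∀ i, MeasurableSet (P i)) {N : Set α} (hN : N ⊆ ⋃ i, P i) {c : ℝ≥0∞}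
    (h : ∀ i, ∀ S ⊆ N ∩ P i, ν (γ '' S) ≤ c * μ S) : ν (γ '' N) ≤ c * μ N := by
  rcases isEmpty_or_nonempty ι with hι | hι
  · have : N = ∅ := by simpa using hN
    simp [this]
  obtain ⟨e, he⟩ := exists_surjective_nat ι
  set Q : ℕ → Set α := disjointed fun m ↦ P (e m)
  have hQ (m : ℕ) : MeasurableSet (Q m) := MeasurableSet.disjointed (fun _ ↦ hP _) m
  have hUQ : N ⊆ ⋃ m, Q m := by rwa [iUnion_disjointed, he.iUnion_comp]
  have hNQ : N = ⋃ m, N ∩ Q m := by rw [← inter_iUnion, inter_eq_left.2 hUQ]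
  calc ν (γ '' N) = ν (⋃ m, γ '' (N ∩ Q m)) := by rw [← image_iUnion, ← hNQ]
    _ ≤ ∑' m, ν (γ '' (N ∩ Q m)) := measure_iUnion_le _
    _ ≤ ∑' m, c * μ (N ∩ Q m) := by
      gcongr with m
      exact h (e m) _ (inter_subset_inter_right _ (disjointed_subset _ _))
    _ = c * ∑' m, (μ.restrict N) (Q m) := by
      rw [ENNReal.tsum_mul_left]
      congr! 3 with m
      rw [Measure.restrict_apply (hQ m), inter_comm]
    _ = c * (μ.restrict N) (⋃ m, Q m) := by
      rw [measure_iUnion (disjoint_disjointed _) hQ]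
    _ ≤ c * μ N := by
      refine mul_le_mul' le_rfl ?_
      exact (measure_mono (subset_univ _)).trans (Measure.restrict_apply_univ N).le

/-- The image of the set of points at which the derivatives of all the functions `F j`, which
determine the metric of the target, have a common nontrivial kernel is negligible. -/
lemma hausdorffMeasure_image_eq_zero_of_fderiv_degenerate {E X : Type*} [NormedAddCommGroup E]
    [InnerProductSpace ℝ E] [FiniteDimensional ℝ E] [MeasurableSpace E] [BorelSpace E]
    [MetricSpace X] [MeasurableSpace X] [BorelSpace X] {n : ℕ}
    [(μH[(n : ℝ)] : Measure E).IsAddHaarMeasure] {γ : E → X} {N : Set E} {F : ℕ → E → ℝ}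
    {K M : ℝ≥0} (hF : ∀ j, LipschitzWith K (F j)) (hγM : LipschitzOnWith M γ N)
    (hγ : ∀ x ∈ N, ∀ y ∈ N, ∀ C, (∀ j, |F j x - F j y| ≤ C) → dist (γ x) (γ y) ≤ C)
    (hN : ∀ x ∈ N, ∃ v ≠ 0, ∀ j, DifferentiableAt ℝ (F j) x ∧ fderiv ℝ (F j) x v = 0) :
    μH[(n : ℝ)] (γ '' N) = 0 := by
  have key (q : ℝ) (hq : 0 < q) (N' : Set E) (hN' : N' ⊆ N) :
      μH[(n : ℝ)] (γ '' N') ≤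
        ((1 + K : ℝ≥0) : ℝ≥0∞) ^ n * ENNReal.ofReal (2 * q) * μH[(n : ℝ)] N' := by
    obtain ⟨D, hDc, hDd⟩ := TopologicalSpace.exists_countable_dense (sphere (0 : E) 1)
    have : Countable D := hDc
    have hae : ∀ᵐ x ∂(μH[(n : ℝ)] : Measure E), ∀ v : D, (∀ j, |lineDeriv ℝ (F j) x v| ≤ q) →
        ∃ k : ℕ, ∀ s : ℝ, |s| ≤ 1 / (k + 1) →
          ∀ j, |F j (x + s • (v : E)) - F j x| ≤ 2 * q * |s| :=
      ae_all_iff.2 fun v ↦ ae_exists_forall_abs_sub_le_of_lineDeriv _ hF _ hq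
    set G : Set E := {x | ∀ v : D, (∀ j, |lineDeriv ℝ (F j) x v| ≤ q) →
        ∃ k : ℕ, ∀ s : ℝ, |s| ≤ 1 / (k + 1) →
          ∀ j, |F j (x + s • (v : E)) - F j x| ≤ 2 * q * |s|}
    have hbad : μH[(n : ℝ)] (γ '' (N' \ G)) = 0 := by
      have h0 : μH[(n : ℝ)] (N' \ G) = 0 := measure_mono_null (fun x hx ↦ hx.2) hae
      have := (hγM.mono (sdiff_subset.trans hN' : N' \ G ⊆ N)).hausdorffMeasure_image_le
        (Nat.cast_nonneg n)
      simpa [h0] using this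
    let P (i : D × ℕ × ℕ) : Set E :=
      {x | ∀ s : ℝ, |s| ≤ 1 / (i.2.1 + 1) →
        ∀ j, |F j (x + s • (i.1 : E)) - F j x| ≤ 2 * q * |s|} ∩
      closedBall (TopologicalSpace.denseSeq E i.2.2) (1 / (i.2.1 + 1) / 2)
    have hP (i) : MeasurableSet (P i) := by
      refine MeasurableSet.inter (IsClosed.measurableSet ?_) measurableSet_closedBall
      simp only [Set.ofPred_forall]
      have (j : ℕ) : Continuous (F j) := (hF j).continuous
      exact isClosed_iInter fun s ↦ isClosed_iInter fun _ ↦ isClosed_iInter fun j ↦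
        isClosed_le (by fun_prop) continuous_const
    have hcover : N' ∩ G ⊆ ⋃ i, P i := by
      rintro x ⟨hx, hxG⟩
      obtain ⟨v, hv0, hv⟩ := hN x (hN' hx)
      have hpos : 0 < ‖v‖ := norm_pos_iff.2 hv0
      let u : sphere (0 : E) 1 := ⟨‖v‖⁻¹ • v, by simp [norm_smul, hpos.ne']⟩
      obtain ⟨w, hwD, hw⟩ := hDd.exists_dist_lt u (show 0 < q / (K + 1) by positivity)
      have hline (j : ℕ) : |lineDeriv ℝ (F j) x (w : E)| ≤ q := by
        rw [(hv j).1.lineDeriv_eq_fderiv]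
        have hu : fderiv ℝ (F j) x (u : E) = 0 := by simp [u, (hv j).2]
        have hsub : fderiv ℝ (F j) x (w : E) = fderiv ℝ (F j) x ((w : E) - u) := by
          rw [map_sub, hu, sub_zero]
        rw [hsub, ← Real.norm_eq_abs]
        refine ((fderiv ℝ (F j) x).le_opNorm _).trans ?_
        have h1 : ‖fderiv ℝ (F j) x‖ ≤ K := norm_fderiv_le_of_lipschitz ℝ (hF j)
        have h2 : ‖(w : E) - u‖ ≤ q / (K + 1) := by
          rw [← dist_eq_norm, dist_comm]; exact hw.le
        calc _ ≤ (K : ℝ) * (q / (K + 1)) := by gcongr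
          _ ≤ (K + 1) * (q / (K + 1)) := by gcongr; simp
          _ = q := by field_simp
      obtain ⟨k, hk⟩ := hxG ⟨w, hwD⟩ hline
      obtain ⟨c, hc⟩ := (TopologicalSpace.denseRange_denseSeq E).exists_dist_lt x
        (show (0 : ℝ) < 1 / (k + 1) / 2 by positivity)
      exact mem_iUnion.2 ⟨(⟨w, hwD⟩, k, c), hk, hc.le⟩
    have hgood : μH[(n : ℝ)] (γ '' (N' ∩ G)) ≤
        ((1 + K : ℝ≥0) : ℝ≥0∞) ^ n * ENNReal.ofReal (2 * q) * μH[(n : ℝ)] (N' ∩ G) := by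
      refine measure_image_le_of_countable_cover hP hcover fun i S hS ↦ ?_
      have hSN : S ⊆ N := fun x hx ↦ hN' (hS hx).1.1
      have hv : ‖((i.1 : sphere (0 : E) 1) : E)‖ = 1 := by simp
      refine hausdorffMeasure_image_le_of_contracted_direction hF
        (fun x hx y hy ↦ hγ x (hSN hx) y (hSN hy)) hv (by positivity) fun x hx y hy j ↦ ?_
      refine (hS hx).2.1 _ ?_ j
      refine (abs_real_inner_le_norm _ _).trans ?_
      rw [hv, one_mul, ← dist_eq_norm]
      have h1 := (hS hx).2.2
      have h2 := (hS hy).2.2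
      rw [mem_closedBall] at h1 h2
      linarith [dist_triangle_right y x (TopologicalSpace.denseSeq E i.2.2)]
    calc μH[(n : ℝ)] (γ '' N') = μH[(n : ℝ)] (γ '' (N' ∩ G) ∪ γ '' (N' \ G)) := by
          rw [← image_union, inter_union_sdiff]
      _ ≤ μH[(n : ℝ)] (γ '' (N' ∩ G)) + μH[(n : ℝ)] (γ '' (N' \ G)) := measure_union_le _ _
      _ ≤ _ := by
        rw [hbad, add_zero]
        exact hgood.trans (by gcongr; exact inter_subset_left)
  have hUN : γ '' N = ⋃ m : ℕ, γ '' (N ∩ ball 0 m) := by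
    rw [← image_iUnion, ← inter_iUnion, iUnion_ball_nat, inter_univ]
  rw [hUN, measure_iUnion_null_iff]
  intro m
  have hfin : μH[(n : ℝ)] (N ∩ ball 0 m) ≠ ∞ :=
    ((measure_mono inter_subset_right).trans_lt measure_ball_lt_top).ne
  have hlim : Tendsto (fun q : ℝ ↦ ((1 + K : ℝ≥0) : ℝ≥0∞) ^ n * ENNReal.ofReal (2 * q) *
      μH[(n : ℝ)] (N ∩ ball 0 m)) (𝓝[>] 0) (𝓝 0) := by
    have h1 : Tendsto (fun q : ℝ ↦ ENNReal.ofReal (2 * q)) (𝓝[>] 0) (𝓝 0) := by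
      have : Continuous fun q : ℝ ↦ ENNReal.ofReal (2 * q) :=
        ENNReal.continuous_ofReal.comp (continuous_const_mul 2)
      simpa using (this.tendsto 0).mono_left nhdsWithin_le_nhds
    have h2 := ENNReal.Tendsto.mul_const
      (ENNReal.Tendsto.const_mul (a := ((1 + K : ℝ≥0) : ℝ≥0∞) ^ n) h1 (Or.inr (by finiteness)))
      (b := μH[(n : ℝ)] (N ∩ ball 0 m)) (Or.inr hfin)
    simpa using h2
  refine le_antisymm (ge_of_tendsto hlim ?_) zero_le
  filter_upwards [self_mem_nhdsWithin] with q hq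
  exact key q hq _ inter_subset_left

/-- A map that is differentiable with invertible derivative at each point of a set of positive
measure maps it to a set of positive measure. -/
lemma measure_image_ne_zero_of_det_ne_zero {E : Type*} [NormedAddCommGroup E] [NormedSpace ℝ E]
    [FiniteDimensional ℝ E] [MeasurableSpace E] [BorelSpace E] (μ : Measure E)
    [μ.IsAddHaarMeasure] {h : E → E} {h' : E → E →L[ℝ] E} {s : Set E}
    (hd : ∀ x ∈ s, HasFDerivWithinAt h (h' x) s x) (hdet : ∀ x ∈ s, (h' x).det ≠ 0)
    (hs : μ s ≠ 0) : μ (h '' s) ≠ 0 := by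
  have hr (A : E →L[ℝ] E) : ∃ δ : ℝ≥0, δ ≠ 0 ∧ (A.det ≠ 0 → ∃ m : ℝ≥0, m ≠ 0 ∧
      ∀ (s : Set E) (f : E → E), ApproximatesLinearOn f A s δ → (m : ℝ≥0∞) * μ s ≤ μ (f '' s)) := by
    by_cases hA : A.det = 0
    · exact ⟨1, one_ne_zero, fun h ↦ (h hA).elim⟩
    · have h0 : 0 < ENNReal.ofReal |A.det| := by simpa using hA
      obtain ⟨m, hm0, hm⟩ := ENNReal.lt_iff_exists_nnreal_btwn.1 h0
      obtain ⟨δ, h1, h2⟩ :=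
        ((mul_le_addHaar_image_of_lt_det μ A hm).and self_mem_nhdsWithin).exists
      exact ⟨δ, (ne_of_gt h2), fun _ ↦ ⟨m, by simpa using hm0.ne', h1⟩⟩
  choose r hr0 hr using hr
  obtain ⟨t, A, -, -, hst, happ, hA⟩ :=
    exists_partition_approximatesLinearOn_of_hasFDerivWithinAt h s h' hd r hr0
  have hne : s.Nonempty := nonempty_of_measure_ne_zero hs
  intro hzero
  refine hs ?_
  rw [← inter_eq_left.2 hst, inter_iUnion, measure_iUnion_null_iff]
  intro i
  obtain ⟨y, hy, hAy⟩ := hA hne i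
  obtain ⟨m, hm0, hm⟩ := hr (A i) (by rw [hAy]; exact hdet y hy)
  have h1 := (hm _ _ (happ i)).trans (measure_mono (image_mono inter_subset_left))
  rw [hzero] at h1
  simpa [hm0] using h1

/-- If countably many linear functionals on a finite-dimensional space have trivial common kernel,
then so do finitely many of them, as many as the dimension. -/
lemma exists_fin_forall_eq_zero_of_forall_eq_zero {E : Type*} [AddCommGroup E] [Module ℝ E]
    [FiniteDimensional ℝ E] {n : ℕ} (hn : finrank ℝ E = n) (D : ℕ → Module.Dual ℝ E)
    (hD : ∀ v, (∀ j, D j v = 0) → v = 0) :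
    ∃ τ : Fin n → ℕ, ∀ v, (∀ i, D (τ i) v = 0) → v = 0 := by
  have hspan : Submodule.span ℝ (range D) = ⊤ := by
    rw [← Subspace.dualCoannihilator_dualAnnihilator_eq (W := Submodule.span ℝ (range D))]
    have : (Submodule.span ℝ (range D)).dualCoannihilator = ⊥ := by
      refine (Submodule.eq_bot_iff _).2 fun v hv ↦ hD v fun j ↦ ?_
      exact (Submodule.mem_dualCoannihilator v).1 hv _ (Submodule.subset_span ⟨j, rfl⟩)
    rw [this, Submodule.dualAnnihilator_bot]
  have hrank : finrank ℝ (Submodule.span ℝ (range D)) = n := by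
    rw [hspan, finrank_top, Subspace.dual_finrank_eq, hn]
  obtain ⟨φ, hφ, hφspan, -⟩ := Submodule.exists_fun_fin_finrank_span_eq ℝ (range D)
  choose τ hτ using hφ
  refine ⟨fun i ↦ τ (finCongr hrank.symm i), fun v hv ↦ ?_⟩
  rw [← Module.forall_dual_apply_eq_zero_iff ℝ]
  have hle : Submodule.span ℝ (range φ) ≤ LinearMap.ker (Module.Dual.eval ℝ E v) := by
    rw [Submodule.span_le]
    rintro _ ⟨i, rfl⟩
    simpa [hτ] using hv (finCongr hrank i)
  intro f
  exact hle (by rw [hφspan, hspan]; trivial)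

/-- If a Lipschitz map `γ` on a subset of a Euclidean space has an image of positive Hausdorff
measure, then some `n`-tuple of distance functions, composed with `γ`, has an invertible derivative
on a set of positive measure. -/
lemma exists_dist_comp_fderiv_injective {X : Type*} [MetricSpace X] [MeasurableSpace X]
    [BorelSpace X] {n : ℕ} [(μH[(n : ℝ)] : Measure (EuclideanSpace ℝ (Fin n))).IsAddHaarMeasure]
    {γ : EuclideanSpace ℝ (Fin n) → X} {N : Set (EuclideanSpace ℝ (Fin n))} {M : ℝ≥0}
    (hγ : LipschitzOnWith M γ N) (hN : μH[(n : ℝ)] (γ '' N) ≠ 0) :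
    ∃ (y : Fin n → X) (H : EuclideanSpace ℝ (Fin n) → EuclideanSpace ℝ (Fin n))
      (N' : Set (EuclideanSpace ℝ (Fin n))), N' ⊆ N ∧ μH[(n : ℝ)] N' ≠ 0 ∧
      (∀ x ∈ N', ∀ i, H x i = dist (γ x) (y i)) ∧
      ∀ x ∈ N', DifferentiableAt ℝ H x ∧ (fderiv ℝ H x).det ≠ 0 := by
  have hne : Nonempty N := (nonempty_of_measure_ne_zero hN).of_image.to_subtype
  let a : ℕ → N := TopologicalSpace.denseSeq N
  have hext (j : ℕ) : ∃ F : EuclideanSpace ℝ (Fin n) → ℝ,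
      LipschitzWith M F ∧ EqOn (fun x ↦ dist (γ x) (γ (a j))) F N := by
    refine LipschitzOnWith.extend_real ?_
    simpa [Function.comp_def] using (LipschitzWith.dist_left (γ (a j))).comp_lipschitzOnWith hγ
  choose F hF hFγ using hext
  have hdist (x) (hx : x ∈ N) (y) (hy : y ∈ N) (C : ℝ) (hC : ∀ j, |F j x - F j y| ≤ C) :
      dist (γ x) (γ y) ≤ C := by
    have hall (z : N) : |dist (γ x) (γ z) - dist (γ y) (γ z)| ≤ C := by
      refine (TopologicalSpace.denseRange_denseSeq N).induction_on
        (p := fun z : N ↦ |dist (γ x) (γ z) - dist (γ y) (γ z)| ≤ C) z ?_ fun j ↦ ?_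
      · have : Continuous fun z : N ↦ γ z :=
          continuousOn_iff_continuous_domRestrict.1 hγ.continuousOn
        exact isClosed_le ((continuous_const.dist this).sub (continuous_const.dist this)).abs
          continuous_const
      · have := hC j
        rwa [← hFγ j hx, ← hFγ j hy] at this
    simpa using hall ⟨y, hy⟩
  have hae : ∀ᵐ x ∂(μH[(n : ℝ)] : Measure (EuclideanSpace ℝ (Fin n))),
      ∀ j, DifferentiableAt ℝ (F j) x :=
    ae_all_iff.2 fun j ↦ (hF j).ae_differentiableAt
  set R : (Fin n → ℕ) → Set (EuclideanSpace ℝ (Fin n)) := fun τ ↦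
    {x ∈ N | (∀ j, DifferentiableAt ℝ (F j) x) ∧
      ∀ v, (∀ i, fderiv ℝ (F (τ i)) x v = 0) → v = 0}
  have hpos : ∃ τ, μH[(n : ℝ)] (R τ) ≠ 0 := by
    by_contra! hcon
    set Z : Set (EuclideanSpace ℝ (Fin n)) :=
      {x ∈ N | ∃ v ≠ 0, ∀ j, DifferentiableAt ℝ (F j) x ∧ fderiv ℝ (F j) x v = 0}
    have hZN : Z ⊆ N := fun x hx ↦ hx.1
    have hZ : μH[(n : ℝ)] (γ '' Z) = 0 :=
      hausdorffMeasure_image_eq_zero_of_fderiv_degenerate hF (hγ.mono hZN)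
        (fun x hx y hy ↦ hdist x (hZN hx) y (hZN hy)) fun x hx ↦ hx.2
    have hNZ : μH[(n : ℝ)] (N \ Z) = 0 := by
      refine measure_mono_null (t := (⋃ τ, R τ) ∪ {x | ¬ ∀ j, DifferentiableAt ℝ (F j) x}) ?_
        (measure_union_null (measure_iUnion_null hcon) hae)
      rintro x ⟨hxN, hxZ⟩
      by_cases hx : ∀ j, DifferentiableAt ℝ (F j) x
      · left
        obtain ⟨τ, hτ⟩ := exists_fin_forall_eq_zero_of_forall_eq_zero (n := n)
          (E := EuclideanSpace ℝ (Fin n)) finrank_euclideanSpace_fin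
          (fun j ↦ (fderiv ℝ (F j) x : EuclideanSpace ℝ (Fin n) →ₗ[ℝ] ℝ)) fun v hv ↦ by
            by_contra hv0
            exact hxZ ⟨hxN, v, hv0, fun j ↦ ⟨hx j, hv j⟩⟩
        exact mem_iUnion.2 ⟨τ, hxN, hx, hτ⟩
      · exact Or.inr hx
    have hNZ' : μH[(n : ℝ)] (γ '' (N \ Z)) = 0 := by
      have := (hγ.mono (sdiff_subset : N \ Z ⊆ N)).hausdorffMeasure_image_le (Nat.cast_nonneg n)
      simpa [hNZ] using this
    refine hN (measure_mono_null ?_ (measure_union_null hZ hNZ'))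
    rw [← image_union, union_sdiff_cancel hZN]
  obtain ⟨τ, hτ⟩ := hpos
  have hder (x) (hx : x ∈ R τ) : HasFDerivAt
      (fun x ↦ WithLp.toLp 2 fun i ↦ F (τ i) x :
        EuclideanSpace ℝ (Fin n) → EuclideanSpace ℝ (Fin n))
      (((PiLp.continuousLinearEquiv 2 ℝ fun _ : Fin n ↦ ℝ).symm :
        (Fin n → ℝ) →L[ℝ] EuclideanSpace ℝ (Fin n)).comp
        (ContinuousLinearMap.pi fun i ↦ fderiv ℝ (F (τ i)) x)) x :=
    (((PiLp.continuousLinearEquiv 2 ℝ fun _ : Fin n ↦ ℝ).symm :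
      (Fin n → ℝ) →L[ℝ] EuclideanSpace ℝ (Fin n)).hasFDerivAt).comp x
      (hasFDerivAt_pi.2 fun i ↦ (hx.2.1 (τ i)).hasFDerivAt)
  refine ⟨fun i ↦ γ (a (τ i)), fun x ↦ WithLp.toLp 2 fun i ↦ F (τ i) x, R τ, fun x hx ↦ hx.1, hτ,
    fun x hx i ↦ (hFγ (τ i) hx.1).symm, fun x hx ↦ ⟨(hder x hx).differentiableAt, ?_⟩⟩
  rw [(hder x hx).fderiv]
  refine fun h0 ↦ (LinearMap.bot_lt_ker_of_det_eq_zero h0).ne' ?_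
  refine LinearMap.ker_eq_bot'.2 fun v hv ↦ hx.2.2 v fun i ↦ ?_
  simpa using congrArg (fun z : EuclideanSpace ℝ (Fin n) ↦ z i) hv

/-- If `B` is invertible, then `A + t • B` is invertible for all `t` outside of a finite set. -/
lemma finite_setOf_det_add_smul_eq_zero {E : Type*} [NormedAddCommGroup E] [NormedSpace ℝ E]
    [FiniteDimensional ℝ E] (A B : E →L[ℝ] E) (hB : B.det ≠ 0) :
    {t : ℝ | (A + t • B).det = 0}.Finite := by
  let B' : E ≃ₗ[ℝ] E := (B : E →ₗ[ℝ] E).equivOfDetNeZero hB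
  refine (Module.End.finite_hasEigenvalue
    (-((B'.symm : E →ₗ[ℝ] E) ∘ₗ (A : E →ₗ[ℝ] E)))).subset fun t ht ↦ ?_
  obtain ⟨v, hv, hv0⟩ := (Submodule.ne_bot_iff _).1 (LinearMap.bot_lt_ker_of_det_eq_zero ht).ne'
  refine Module.End.hasEigenvalue_of_hasEigenvector (x := v)
    ⟨Module.End.mem_eigenspace_iff.2 ?_, hv0⟩
  have h1 : A v + t • B v = 0 := by simpa using hv
  have h2 : A v = -B' (t • v) := by
    rw [map_smul]
    exact eq_neg_of_add_eq_zero_left h1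
  simp [h2]

/-- On a rectifiable set of positive measure there is a bounded Lipschitz function such that every
Lipschitz function has arbitrarily small perturbations in its direction whose image of the set has
positive measure. -/
lemma exists_perturbation_hausdorffMeasure_image_pos {X V : Type*} [MetricSpace X]
    [MeasurableSpace X] [BorelSpace X] {n : ℕ} {S : Set X} (hrect : IsRectifiable n S)
    (hpos : 0 < μH[(n : ℝ)] S) [NormedAddCommGroup V] [NormedSpace ℝ V] [FiniteDimensional ℝ V]
    [MeasurableSpace V] [BorelSpace V] (hdim : n ≤ finrank ℝ V) :
    ∃ (φ : X → V) (M : ℝ≥0) (C : ℝ), LipschitzWith M φ ∧ (∀ x, ‖φ x‖ ≤ C) ∧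
      ∀ (f : X → V) (K : ℝ≥0), LipschitzWith K f → ∀ t₀ : ℝ, 0 < t₀ →
        ∃ t : ℝ, 0 < t ∧ t ≤ t₀ ∧ 0 < μH[(n : ℝ)] ((fun x ↦ f x + t • φ x) '' S) := by
  have hHaar : (μH[(n : ℝ)] : Measure (EuclideanSpace ℝ (Fin n))).IsAddHaarMeasure := by
    simpa using isAddHaarMeasure_hausdorffMeasure (E := EuclideanSpace ℝ (Fin n))
  obtain ⟨-, A, γ, hγ, hcov⟩ := hrect
  obtain ⟨i, hi⟩ : ∃ i, μH[(n : ℝ)] (γ i '' A i ∩ S) ≠ 0 := by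
    by_contra! hcon
    refine hpos.ne' (measure_mono_null ?_ (measure_union_null hcov (measure_iUnion_null hcon)))
    rw [← iUnion_inter, inter_comm, sdiff_union_inter]
  obtain ⟨Kγ, hγ⟩ := hγ i
  set N := A i ∩ γ i ⁻¹' S
  have hγN : LipschitzOnWith Kγ (γ i) N := hγ.mono inter_subset_left
  rw [← image_inter_preimage] at hi
  obtain ⟨y, H, N₁, hN₁, hN₁pos, hH, hH'⟩ := exists_dist_comp_fderiv_injective hγN hi
  obtain ⟨R, hR⟩ : ∃ R : ℕ, μH[(n : ℝ)] (N₁ ∩ {x | ∀ k, dist (γ i x) (y k) ≤ R}) ≠ 0 := by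
    by_contra! hcon
    refine hN₁pos (measure_mono_null (fun x hx ↦ ?_) (measure_iUnion_null hcon))
    obtain ⟨R, hR⟩ := exists_nat_ge (∑ k, dist (γ i x) (y k))
    refine mem_iUnion.2 ⟨R, hx, fun k ↦ le_trans ?_ hR⟩
    exact Finset.single_le_sum (f := fun k ↦ dist (γ i x) (y k)) (fun _ _ ↦ dist_nonneg)
      (Finset.mem_univ k)
  set N₂ := N₁ ∩ {x | ∀ k, dist (γ i x) (y k) ≤ R}
  obtain ⟨ι, hι⟩ := (finrank_le_iff_exists_linearMap
    (R := ℝ) (M := EuclideanSpace ℝ (Fin n)) (M' := V)).1 (by simpa using hdim)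
  obtain ⟨π, hπ⟩ := ι.exists_leftInverse_of_injective (LinearMap.ker_eq_bot.2 hι)
  let J : (Fin n → ℝ) →L[ℝ] V := ι.toContinuousLinearMap.comp
    ((PiLp.continuousLinearEquiv 2 ℝ fun _ : Fin n ↦ ℝ).symm :
      (Fin n → ℝ) →L[ℝ] EuclideanSpace ℝ (Fin n))
  have hπJ (z : Fin n → ℝ) : π (J z) = WithLp.toLp 2 z := LinearMap.congr_fun hπ _
  let u : X → Fin n → ℝ := fun x k ↦ min (dist x (y k)) R
  have hu : LipschitzWith 1 u := LipschitzWith.of_dist_le_mul fun x x' ↦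
    (dist_pi_le_iff (by positivity)).2 fun k ↦
      ((LipschitzWith.dist_left (y k)).min_const R).dist_le_mul x x'
  have huR (x : X) : ‖u x‖ ≤ R := by
    refine (pi_norm_le_iff_of_nonneg (Nat.cast_nonneg R)).2 fun k ↦ ?_
    rw [Real.norm_of_nonneg (le_min dist_nonneg (Nat.cast_nonneg R))]
    exact min_le_right _ _
  refine ⟨J ∘ u, ‖J‖₊ * 1, ‖J‖ * R, J.lipschitz.comp hu,
    fun x ↦ (J.le_opNorm _).trans (by gcongr; exact huR x), fun f K hf t₀ ht₀ ↦ ?_⟩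
  let π' : V →L[ℝ] EuclideanSpace ℝ (Fin n) := π.toContinuousLinearMap
  obtain ⟨G, hG, hGN⟩ := ((π'.lipschitz.comp hf).comp_lipschitzOnWith hγN).extend_finite_dimension
  have hN₂' : ∃ k : ℕ, μH[(n : ℝ)] {x ∈ N₂ | DifferentiableAt ℝ G x ∧
      (fderiv ℝ G x + (t₀ / (k + 1)) • fderiv ℝ H x).det ≠ 0} ≠ 0 := by
    by_contra! hcon
    refine hR (measure_mono_null ?_
      (measure_union_null (measure_iUnion_null hcon) hG.ae_differentiableAt))
    intro x hx
    by_cases hxG : DifferentiableAt ℝ G x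
    · left
      have hinj : Function.Injective fun k : ℕ ↦ t₀ / ((k : ℝ) + 1) := by
        intro k l hkl
        have : (k : ℝ) + 1 = l + 1 := by
          have h1 : (k : ℝ) + 1 ≠ 0 := by positivity
          have h2 : (l : ℝ) + 1 ≠ 0 := by positivity
          have h3 : t₀ / ((k : ℝ) + 1) = t₀ / ((l : ℝ) + 1) := hkl
          field_simp at h3
          exact h3.symm
        exact_mod_cast add_right_cancel this
      obtain ⟨_, ⟨k, rfl⟩, hk⟩ := ((infinite_range_of_injective hinj).sdiff
        (finite_setOf_det_add_smul_eq_zero (fderiv ℝ G x) (fderiv ℝ H x)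
          (hH' x hx.1).2)).nonempty
      exact mem_iUnion.2 ⟨k, hx, hxG, hk⟩
    · exact Or.inr hxG
  obtain ⟨k, hk⟩ := hN₂'
  set t := t₀ / ((k : ℝ) + 1)
  set N₃ := {x ∈ N₂ | DifferentiableAt ℝ G x ∧ (fderiv ℝ G x + t • fderiv ℝ H x).det ≠ 0}
  refine ⟨t, by positivity, div_le_self ht₀.le (by simp), pos_iff_ne_zero.2 fun hzero ↦ ?_⟩
  have himage := measure_image_ne_zero_of_det_ne_zero (h := fun x ↦ G x + t • H x)
    μH[(n : ℝ)] (s := N₃) (fun x hx ↦ (hx.2.1.hasFDerivAt.add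
      ((hH' x hx.1.1).1.hasFDerivAt.const_smul t)).hasFDerivWithinAt) (fun x hx ↦ hx.2.2) hk
  refine himage (measure_mono_null (t := π' '' ((fun x ↦ f x + t • (J ∘ u) x) '' S)) ?_ ?_)
  · rintro _ ⟨x, hx, rfl⟩
    have hxN : x ∈ N := hN₁ hx.1.1
    refine ⟨_, ⟨γ i x, hxN.2, rfl⟩, ?_⟩
    have hHx : H x = WithLp.toLp 2 (u (γ i x)) := by
      ext k
      rw [hH x hx.1.1]
      exact (min_eq_left (hx.1.2 k)).symm
    have hGx : G x = π (f (γ i x)) := (hGN hxN).symm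
    change π (f (γ i x) + t • J (u (γ i x))) = G x + t • H x
    rw [map_add, map_smul, hπJ, hHx, hGx]
  · have := π'.lipschitz.hausdorffMeasure_image_le (Nat.cast_nonneg n)
      ((fun x ↦ f x + t • (J ∘ u) x) '' S)
    rw [hzero, mul_zero] at this
    exact nonpos_iff_eq_zero.1 this

theorem stmt13 {X : Type*} [MetricSpace X] [CompleteSpace X] [MeasurableSpace X] [BorelSpace X]
    (n : ℕ) (hn : 1 ≤ n) (S : Set X)
    (hrect : IsRectifiable n S) (hpos : 0 < μH[(n : ℝ)] S)
    (V : Type*) [NormedAddCommGroup V] [NormedSpace ℝ V] [FiniteDimensional ℝ V]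
    [MeasurableSpace V] [BorelSpace V] (hdim : n ≤ Module.finrank ℝ V)
    (L : ℝ≥0) (hL : 0 < L)
    (f : LipSpace X V L) (ε : ℝ) (hε : 0 < ε) :
    ∃ g : LipSpace X V L, dist f g < ε ∧ 0 < μH[(n : ℝ)] (⇑g.1 '' S) := by
  obtain ⟨φ, M, C, hφ, hφC, hpert⟩ := exists_perturbation_hausdorffMeasure_image_pos
    (V := V) hrect hpos hdim
  have hf : LipschitzWith L f.1 := f.2
  have hsmall (a b : ℝ) (hb : 0 < b) : ∀ᶠ δ : ℝ in 𝓝[>] 0, δ * a < b := by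
    have : Tendsto (fun δ : ℝ ↦ δ * a) (𝓝[>] 0) (𝓝 (0 * a)) :=
      ((continuous_mul_const a).tendsto 0).mono_left nhdsWithin_le_nhds
    rw [zero_mul] at this
    exact this.eventually_lt_const hb
  obtain ⟨δ, ⟨hδf, hδ1⟩, hδ0 : 0 < δ⟩ := (((hsmall ‖f.1‖ (ε / 4) (by positivity)).and
    (hsmall 1 1 one_pos)).and self_mem_nhdsWithin).exists
  rw [mul_one] at hδ1
  obtain ⟨t₀, ⟨htC, htM⟩, ht₀ : 0 < t₀⟩ := (((hsmall C (ε / 4) (by positivity)).and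
    (hsmall M (δ * L) (by positivity))).and self_mem_nhdsWithin).exists
  obtain ⟨t, ht, htt₀, htpos⟩ := hpert (fun x ↦ (1 - δ) • f.1 x) _
    ((lipschitzWith_smul (1 - δ)).comp hf) t₀ ht₀
  let φb : BoundedContinuousFunction X V :=
    BoundedContinuousFunction.ofNormedAddCommGroup φ hφ.continuous C hφC
  let g : BoundedContinuousFunction X V := (1 - δ) • f.1 + t • φb
  have hgLip : LipschitzWith L g := by
    refine LipschitzWith.of_dist_le_mul fun x x' ↦ ?_
    calc dist (g x) (g x')
        ≤ dist ((1 - δ) • f.1 x) ((1 - δ) • f.1 x') + dist (t • φ x) (t • φ x') :=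
          dist_add_add_le _ _ _ _
      _ = (1 - δ) * dist (f.1 x) (f.1 x') + t * dist (φ x) (φ x') := by
        rw [dist_smul₀, dist_smul₀, Real.norm_of_nonneg (by linarith), Real.norm_of_nonneg ht.le]
      _ ≤ (1 - δ) * (L * dist x x') + t₀ * (M * dist x x') := by
        gcongr
        · exact hf.dist_le_mul x x'
        · exact hφ.dist_le_mul x x'
      _ = ((1 - δ) * L + t₀ * M) * dist x x' := by ring
      _ ≤ L * dist x x' := by
        gcongr
        linarith
  refine ⟨⟨g, hgLip⟩, ?_, htpos⟩
  have hdist : dist f.1 g ≤ ε / 2 := by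
    refine (BoundedContinuousFunction.dist_le (by positivity)).2 fun x ↦ ?_
    have hgx : f.1 x - g x = δ • f.1 x - t • φ x := by
      change f.1 x - ((1 - δ) • f.1 x + t • φ x) = _
      module
    rw [dist_eq_norm, hgx]
    have h1 : δ * ‖f.1 x‖ ≤ δ * ‖f.1‖ := by
      gcongr
      exact f.1.norm_coe_le_norm x
    have h2 : t * ‖φ x‖ ≤ t₀ * C := by
      gcongr
      exact hφC x
    calc ‖δ • f.1 x - t • φ x‖ ≤ ‖δ • f.1 x‖ + ‖t • φ x‖ := norm_sub_le _ _
      _ = δ * ‖f.1 x‖ + t * ‖φ x‖ := by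
        rw [norm_smul, norm_smul, Real.norm_of_nonneg hδ0.le, Real.norm_of_nonneg ht.le]
      _ ≤ ε / 2 := by linarith
  exact hdist.trans_lt (by linarith)
end
end

section
/- Let X be a metric space, B a real Banach space, L ≥ 0, and F : X → B a bounded L-Lipschitz map. Suppose that for some M ∈ ℕ there exist sets S_1, …, S_M ⊆ X and ρ₀ > 0 such that the open neighbourhoods B(S_i, ρ₀) are pairwise disjoint, and for some ε > 0 there exist L-Lipschitz maps σ_i : B(S_i,ρ₀) → B with ‖F(x) − σ_i(x)‖ < ε for each x ∈ B(S_i,ρ₀) and each 1 ≤ i ≤ M. Then there exists an (L + 2ε/ρ₀)-Lipschitz map σ : X → B such that: (1) σ(x) = σ_i(x) for each x ∈ S_i and each 1 ≤ i ≤ M; (2) σ(x) = F(x) whenever d(x, ⋃_i S_i) > ρ₀; (3) ‖σ(x) − F(x)‖ < ε for each x ∈ X. -/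
open MeasureTheory Metric Set Filter
open scoped NNReal ENNReal Topology

noncomputable section

/-- The weight of `x` relative to `S`: it is `1` on `S` and decreases to `0` at distance `ρ`. -/
def cutoffWeight {X : Type*} [MetricSpace X] (ρ : ℝ) (S : Set X) (x : X) : ℝ :=
  1 - infDist x S / ρ

section CutoffWeight

variable {X : Type*} [MetricSpace X] {ρ : ℝ} {S : Set X} {x y : X}

lemma cutoffWeight_le_one (hρ : 0 < ρ) : cutoffWeight ρ S x ≤ 1 := by
  have : 0 ≤ infDist x S / ρ := div_nonneg infDist_nonneg hρ.le
  unfold cutoffWeight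
  linarith

lemma cutoffWeight_eq_one (hx : x ∈ S) : cutoffWeight ρ S x = 1 := by
  simp [cutoffWeight, infDist_zero_of_mem hx]

lemma nonempty_of_mem_thickening (hx : x ∈ thickening ρ S) : S.Nonempty := by
  obtain ⟨z, hz, -⟩ := mem_thickening_iff.1 hx
  exact ⟨z, hz⟩

lemma cutoffWeight_nonneg (hρ : 0 < ρ) (hx : x ∈ thickening ρ S) :
    0 ≤ cutoffWeight ρ S x := by
  obtain ⟨z, hz, hxz⟩ := mem_thickening_iff.1 hx
  have : infDist x S / ρ ≤ 1 :=
    (div_le_one hρ).2 ((infDist_le_dist_of_mem hz).trans hxz.le)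
  unfold cutoffWeight
  linarith

lemma cutoffWeight_sub_le (hρ : 0 < ρ) :
    cutoffWeight ρ S x - cutoffWeight ρ S y ≤ dist x y / ρ := by
  have h : infDist y S ≤ infDist x S + dist x y := by
    rw [dist_comm]; exact infDist_le_infDist_add_dist
  have := div_le_div_of_nonneg_right h hρ.le
  rw [add_div] at this
  unfold cutoffWeight
  linarith

lemma abs_cutoffWeight_sub_le (hρ : 0 < ρ) :
    |cutoffWeight ρ S x - cutoffWeight ρ S y| ≤ dist x y / ρ := by
  refine abs_le.2 ⟨?_, cutoffWeight_sub_le hρ⟩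
  have := cutoffWeight_sub_le (S := S) (x := y) (y := x) hρ
  rw [dist_comm] at this
  linarith

lemma cutoffWeight_le_of_notMem (hρ : 0 < ρ) (hx : x ∈ thickening ρ S)
    (hy : y ∉ thickening ρ S) : cutoffWeight ρ S x ≤ dist x y / ρ := by
  obtain ⟨z, hz⟩ := nonempty_of_mem_thickening hx
  have hle : ρ ≤ infDist y S := by
    refine (le_infDist ⟨z, hz⟩).2 fun w hw => ?_
    by_contra! h
    exact hy (mem_thickening_iff.2 ⟨w, hw, h⟩)
  have hy' : cutoffWeight ρ S y ≤ 0 := by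
    have := (one_le_div hρ).2 hle
    unfold cutoffWeight
    linarith
  linarith [cutoffWeight_sub_le (S := S) (x := x) (y := y) hρ]

end CutoffWeight

/-- A pointwise estimate for interpolating between two values `a`, `b` with weight `s`. -/
lemma norm_interpolation_sub_le {B : Type*} [NormedAddCommGroup B] [NormedSpace ℝ B]
    {a a' b b' : B} {s t K δ ε : ℝ} (hs₀ : 0 ≤ s) (hs₁ : s ≤ 1) (ha : ‖a - a'‖ ≤ K)
    (hb : ‖b - b'‖ ≤ K) (hst : |s - t| ≤ δ) (hab : ‖b' - a'‖ ≤ ε) :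
    ‖(a + s • (b - a)) - (a' + t • (b' - a'))‖ ≤ K + δ * ε := by
  have key : (a + s • (b - a)) - (a' + t • (b' - a')) =
      (1 - s) • (a - a') + s • (b - b') + (s - t) • (b' - a') := by
    module
  rw [key]
  refine (norm_add₃_le).trans ?_
  rw [norm_smul, norm_smul, norm_smul, Real.norm_eq_abs, Real.norm_eq_abs, Real.norm_eq_abs,
    abs_of_nonneg hs₀, abs_of_nonneg (sub_nonneg.2 hs₁)]
  have h₁ := mul_le_mul_of_nonneg_left ha (sub_nonneg.2 hs₁)
  have h₂ := mul_le_mul_of_nonneg_left hb hs₀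
  have h₃ := mul_le_mul hst hab (norm_nonneg _) ((abs_nonneg _).trans hst)
  linarith

theorem stmt16 {X : Type*} [MetricSpace X]
    (B : Type*) [NormedAddCommGroup B] [NormedSpace ℝ B] [CompleteSpace B]
    (L : ℝ≥0) (F : X → B) (hF : LipschitzWith L F) (hFbdd : Bornology.IsBounded (Set.range F))
    (M : ℕ) (S : Fin M → Set X) (ρ₀ : ℝ) (hρ₀ : 0 < ρ₀)
    (hdisj : ∀ i j, i ≠ j → Disjoint (thickening ρ₀ (S i)) (thickening ρ₀ (S j)))
    (ε : ℝ) (hε : 0 < ε)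
    (σ' : Fin M → X → B)
    (hσ'lip : ∀ i, LipschitzOnWith L (σ' i) (thickening ρ₀ (S i)))
    (hσ'close : ∀ i, ∀ x ∈ thickening ρ₀ (S i), ‖F x - σ' i x‖ < ε) :
    ∃ σ : X → B, LipschitzWith (L + Real.toNNReal (2 * ε / ρ₀)) σ ∧
      (∀ i, ∀ x ∈ S i, σ x = σ' i x) ∧
      (∀ x : X, ρ₀ < infDist x (⋃ i, S i) → σ x = F x) ∧
      (∀ x : X, ‖σ x - F x‖ < ε) := by
  let T : Fin M → Set X := fun i => thickening ρ₀ (S i)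
  have huniq : ∀ {i j x}, x ∈ T i → x ∈ T j → i = j := fun {i j x} hi hj => by
    by_contra h
    exact Set.disjoint_left.1 (hdisj i j h) hi hj
  let w : Fin M → X → ℝ := fun i => cutoffWeight ρ₀ (S i)
  open scoped Classical in
  let σ : X → B := fun x =>
    if h : ∃ i, x ∈ T i then F x + w h.choose x • (σ' h.choose x - F x) else F x
  have hin : ∀ {i x}, x ∈ T i → σ x = F x + w i x • (σ' i x - F x) := fun {i x} hi => by
    have h : ∃ i, x ∈ T i := ⟨i, hi⟩
    have hσ : σ x = F x + w h.choose x • (σ' h.choose x - F x) := dif_pos h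
    rw [hσ, huniq h.choose_spec hi]
  have hout : ∀ {x}, (¬ ∃ i, x ∈ T i) → σ x = F x := fun h => dif_neg h
  have hclose : ∀ {i x}, x ∈ T i → ‖σ' i x - F x‖ < ε := fun {i x} hi => by
    rw [norm_sub_rev]; exact hσ'close i x hi
  have hFd : ∀ x y, ‖F x - F y‖ ≤ L * dist x y := fun x y => by
    rw [← dist_eq_norm]; exact hF.dist_le_mul x y
  have hbump : ∀ {i x y}, x ∈ T i → y ∉ T i →
      ‖w i x • (σ' i x - F x)‖ ≤ dist x y / ρ₀ * ε := fun {i x y} hx hy => by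
    rw [norm_smul, Real.norm_of_nonneg (cutoffWeight_nonneg hρ₀ hx)]
    exact mul_le_mul (cutoffWeight_le_of_notMem hρ₀ hx hy) (hclose hx).le (norm_nonneg _)
      (div_nonneg dist_nonneg hρ₀.le)
  have hmixed : ∀ {i x y}, x ∈ T i → (¬ ∃ j, y ∈ T j) →
      ‖σ x - σ y‖ ≤ L * dist x y + dist x y / ρ₀ * ε := fun {i x y} hx hy => by
    rw [hin hx, hout hy, add_sub_right_comm]
    exact (norm_add_le _ _).trans (add_le_add (hFd x y) (hbump hx fun h => hy ⟨i, h⟩))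
  refine ⟨σ, LipschitzWith.of_dist_le_mul fun x y => ?_, fun i x hx => ?_, fun x hx => ?_,
    fun x => ?_⟩
  · have hnn : 0 ≤ dist x y / ρ₀ * ε := by positivity
    have hconst : ((L + Real.toNNReal (2 * ε / ρ₀) : ℝ≥0) : ℝ) * dist x y =
        L * dist x y + 2 * (dist x y / ρ₀ * ε) := by
      rw [NNReal.coe_add, Real.coe_toNNReal _ (by positivity)]
      ring
    rw [hconst, dist_eq_norm (σ x)]
    by_cases hx : ∃ i, x ∈ T i <;> by_cases hy : ∃ j, y ∈ T j
    · obtain ⟨i, hi⟩ := hx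
      obtain ⟨j, hj⟩ := hy
      by_cases hij : i = j
      · subst hij
        rw [hin hi, hin hj]
        have hσd : ‖σ' i x - σ' i y‖ ≤ L * dist x y := by
          rw [← dist_eq_norm]; exact (hσ'lip i).dist_le_mul x hi y hj
        have := norm_interpolation_sub_le (cutoffWeight_nonneg hρ₀ hi)
          (cutoffWeight_le_one hρ₀) (hFd x y) hσd (abs_cutoffWeight_sub_le (y := y) hρ₀)
          (hclose hj).le
        exact this.trans (by linarith)
      · have h₁ := hbump hi fun h => hij (huniq h hj)
        have h₂ := hbump hj fun h => hij (huniq hi h)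
        rw [dist_comm y x] at h₂
        rw [hin hi, hin hj, add_sub_add_comm]
        have h₃ := norm_add_le (F x - F y) (w i x • (σ' i x - F x) - w j y • (σ' j y - F y))
        have h₄ := norm_sub_le (w i x • (σ' i x - F x)) (w j y • (σ' j y - F y))
        linarith [hFd x y]
    · obtain ⟨i, hi⟩ := hx
      linarith [hmixed hi hy]
    · obtain ⟨j, hj⟩ := hy
      have := hmixed hj hx
      rw [norm_sub_rev, dist_comm] at this
      linarith
    · rw [hout hx, hout hy]
      linarith [hFd x y]
  · have hw : w i x = 1 := cutoffWeight_eq_one hx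
    rw [hin (self_subset_thickening hρ₀ _ hx), hw, one_smul, add_sub_cancel]
  · refine hout ?_
    rintro ⟨i, hi⟩
    obtain ⟨z, hz, hxz⟩ := mem_thickening_iff.1 hi
    exact (hx.trans_le (infDist_le_dist_of_mem (mem_iUnion.2 ⟨i, hz⟩))).not_gt hxz
  · by_cases hx : ∃ i, x ∈ T i
    · obtain ⟨i, hi⟩ := hx
      rw [hin hi, add_sub_cancel_left, norm_smul,
        Real.norm_of_nonneg (cutoffWeight_nonneg hρ₀ hi)]
      exact (mul_le_of_le_one_left (norm_nonneg _) (cutoffWeight_le_one hρ₀)).trans_lt (hclose hi)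
    · simpa [hout hx] using hε
end
end
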